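/- There exist absolute constants c₁, c₂, c₃ > 0 and an integer N₀ such that for every integer N > N₀ there exist a trigonometric polynomial P(x) = ∑_{k=1}^N a_k e^{2πi k x} with c₁ ≤ ‖P‖_{L²(𝕋)} ≤ c₂ and a permutation σ of {1,…,N} such that the Lebesgue measure of the set { x ∈ 𝕋 : max_{1≤m≤N} | ∑_{k=1}^m a_{σ(k)} e^{2πi σ(k) x} | > √(log N) } is at least c₃. -/

import Mathlib

open MeasureTheory

/-- The complex exponential `e^{2πinx}`. -/
noncomputable def trigChar (n : ℤ) (x : ℝ) : ℂ :=
  Complex.exp (2 * Real.pi * Complex.I * n * x)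

/-- The `L²` norm over one period `[0,1]` of the torus `𝕋 = ℝ/ℤ`. -/
noncomputable def l2normT {E : Type*} [NormedAddCommGroup E] (f : ℝ → E) : ℝ :=
  (∫ x in (0:ℝ)..1, ‖f x‖ ^ 2) ^ ((1:ℝ)/2)

noncomputable def sqw (x : ℝ) : ℝ := if Int.fract x < 1/2 then 1 else -1

noncomputable def fc (f : ℝ → ℂ) (i : ℤ) : ℂ := ∫ x in (0:ℝ)..1, trigChar (-i) x * f x

lemma trigChar_add (i j : ℤ) (x : ℝ) : trigChar (i + j) x = trigChar i x * trigChar j x := by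
  unfold trigChar; rw [← Complex.exp_add]; congr 1; push_cast; ring

lemma trigChar_zero (x : ℝ) : trigChar 0 x = 1 := by simp [trigChar]

lemma norm_trigChar (i : ℤ) (x : ℝ) : ‖trigChar i x‖ = 1 := by
  unfold trigChar
  have : (2 * Real.pi * Complex.I * i * x : ℂ) = ((2 * Real.pi * i * x : ℝ) : ℂ) * Complex.I := by
    push_cast; ring
  rw [this, Complex.norm_exp_ofReal_mul_I]

lemma trigChar_mul (i m : ℤ) (x : ℝ) : trigChar i (m * x) = trigChar (i * m) x := by
  unfold trigChar; congr 1; push_cast; ring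

lemma continuous_trigChar (i : ℤ) : Continuous (trigChar i) := by
  unfold trigChar; fun_prop

lemma trigChar_periodic (i : ℤ) : Function.Periodic (trigChar i) 1 := by
  intro x
  unfold trigChar
  rw [Complex.exp_eq_exp_iff_exists_int]
  exact ⟨i, by push_cast; ring⟩

lemma fc_eq (f : ℝ → ℂ) (i : ℤ) : fourierCoeffOn zero_lt_one f i = fc f i := by
  rw [fourierCoeffOn_eq_integral]
  simp only [fc, sub_zero, ne_eq, one_ne_zero, not_false_eq_true, div_self, one_smul, smul_eq_mul]
  congr 1
  ext x
  congr 1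
  rw [fourier_coe_apply]
  unfold trigChar
  push_cast; simp

lemma integral_trigChar (i : ℤ) : ∫ x in (0:ℝ)..1, trigChar i x = if i = 0 then 1 else 0 := by
  split_ifs with h
  · subst h; simp [trigChar_zero]
  · unfold trigChar
    rw [integral_exp_mul_complex]
    · have : Complex.exp (2 * Real.pi * Complex.I * i * (1:ℝ)) = 1 := by
        rw [Complex.exp_eq_one_iff]; exact ⟨i, by push_cast; ring⟩
      rw [this]; simp
    · simp [h, Real.pi_ne_zero]

lemma fc_poly (F : Finset ℤ) (a : ℤ → ℂ) (i : ℤ) :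
    fc (fun x => ∑ j ∈ F, a j * trigChar j x) i = if i ∈ F then a i else 0 := by
  unfold fc
  have : ∀ x, trigChar (-i) x * ∑ j ∈ F, a j * trigChar j x = ∑ j ∈ F, a j * trigChar (-i + j) x := by
    intro x; rw [Finset.mul_sum]; refine Finset.sum_congr rfl fun j _ => ?_
    rw [trigChar_add]; ring
  simp_rw [this]
  rw [intervalIntegral.integral_finsetSum]
  · simp_rw [intervalIntegral.integral_const_mul, integral_trigChar]
    have : ∀ j, (-i + j = 0) ↔ i = j := fun j => by constructor <;> intro h <;> linarith
    simp [this]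
  · intro j _
    exact ((continuous_trigChar _).const_mul _ |>.comp continuous_id |>.intervalIntegrable _ _)

lemma poly_norm (F : Finset ℤ) (a : ℤ → ℂ) :
    ∫ x in (0:ℝ)..1, ‖∑ j ∈ F, a j * trigChar j x‖ ^ 2 = ∑ j ∈ F, ‖a j‖ ^ 2 := by
  have hc : Continuous (fun x : ℝ => ∑ j ∈ F, a j * trigChar j x) :=
    continuous_finsetSum _ fun j _ => (continuous_trigChar j).const_mul _
  have hm : MemLp (fun x : ℝ => ∑ j ∈ F, a j * trigChar j x) 2 (volume.restrict (Set.Ioc (0:ℝ) 1)) := by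
    refine MemLp.of_bound hc.aestronglyMeasurable (∑ j ∈ F, ‖a j‖) (Filter.Eventually.of_forall ?_)
    intro x
    refine (norm_sum_le _ _).trans (Finset.sum_le_sum fun j _ => ?_)
    rw [norm_mul, norm_trigChar, mul_one]
  have h := hasSum_sq_fourierCoeffOn zero_lt_one hm
  simp only [fc_eq, fc_poly, sub_zero, inv_one, one_smul] at h
  refine h.unique ?_
  have h2 := hasSum_sum_of_ne_finset_zero (f := fun i => ‖(if i ∈ F then a i else 0)‖ ^ 2) (s := F) (L := SummationFilter.unconditional ℤ)
    (fun b hb => by simp [hb])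
  convert h2 using 1
  exact Finset.sum_congr rfl fun j hj => by simp [hj]

lemma sqw_measurable : Measurable sqw := by
  unfold sqw
  exact Measurable.ite (measurableSet_lt measurable_fract measurable_const) measurable_const measurable_const

lemma sqw_abs (x : ℝ) : |sqw x| = 1 := by unfold sqw; split_ifs <;> simp

lemma sqw_cases (x : ℝ) : sqw x = 1 ∨ sqw x = -1 := by unfold sqw; split_ifs <;> simp

lemma sqw_periodic : Function.Periodic sqw 1 := by
  intro x; simp [sqw]

noncomputable def dd (i : ℤ) : ℂ := fc (fun x => (sqw x : ℂ)) i

lemma dd_split (i : ℤ) : dd i = (∫ x in (0:ℝ)..(1/2), trigChar (-i) x) - ∫ x in (1/2:ℝ)..1, trigChar (-i) x := by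
  unfold dd fc
  have hi : ∀ a b : ℝ, IntervalIntegrable (fun x => trigChar (-i) x * (sqw x : ℂ)) volume a b := by
    intro a b
    have h1 : IntervalIntegrable (trigChar (-i)) volume a b :=
      (continuous_trigChar (-i)).intervalIntegrable a b
    have : IntervalIntegrable (fun x => trigChar (-i) x * (sqw x : ℂ)) volume a b := by
      refine h1.mono_fun ?_ ?_
      · exact ((continuous_trigChar _).measurable.mul
          (Complex.measurable_ofReal.comp sqw_measurable)).aestronglyMeasurable
      · refine Filter.Eventually.of_forall fun x => ?_
        simp [sqw_abs]
    exact this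
  rw [← intervalIntegral.integral_add_adjacent_intervals (hi 0 (1/2)) (hi (1/2) 1), sub_eq_add_neg,
    ← intervalIntegral.integral_neg]
  congr 1
  · refine intervalIntegral.integral_congr_ae ?_
    have : ∀ᵐ x : ℝ, x ≠ 1/2 := by simp [ae_iff, measure_singleton]
    filter_upwards [this] with x hx hx2
    rw [Set.uIoc_of_le (by norm_num)] at hx2
    have hx3 : x < 1/2 := lt_of_le_of_ne hx2.2 hx
    have : Int.fract x = x := Int.fract_eq_self.2 ⟨hx2.1.le, by linarith⟩
    simp only [sqw, this, hx3, if_true]; simp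
  · refine intervalIntegral.integral_congr_ae ?_
    have : ∀ᵐ x : ℝ, x ≠ 1 := by simp [ae_iff, measure_singleton]
    filter_upwards [this] with x hx hx2
    rw [Set.uIoc_of_le (by norm_num)] at hx2
    have hx3 : x < 1 := lt_of_le_of_ne hx2.2 hx
    have : Int.fract x = x := Int.fract_eq_self.2 ⟨by linarith [hx2.1], by linarith⟩
    have h4 : ¬ (x < 1/2) := by linarith [hx2.1]
    simp only [sqw, this, h4, if_false]; simp

lemma dd_zero : dd 0 = 0 := by
  rw [dd_split]; simp [trigChar_zero]; norm_num

lemma dd_bound (j : ℤ) (hj : j ≠ 0) : ‖dd j‖ ≤ 1 / |(j:ℝ)| := by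
  have hc : (2 * Real.pi * Complex.I * ((-j : ℤ) : ℂ)) ≠ 0 := by simp [hj, Real.pi_ne_zero]
  have hI : ∀ a b : ℝ, ∫ x in a..b, trigChar (-j) x
      = (trigChar (-j) b - trigChar (-j) a) / (2 * Real.pi * Complex.I * ((-j : ℤ) : ℂ)) := by
    intro a b; unfold trigChar; rw [integral_exp_mul_complex hc]
  have hn : ‖(2 * Real.pi * Complex.I * ((-j : ℤ) : ℂ))‖ = 2 * Real.pi * |(j:ℝ)| := by
    simp [abs_of_pos Real.pi_pos]
  have hb : ∀ a b : ℝ, ‖∫ x in a..b, trigChar (-j) x‖ ≤ 2 / (2 * Real.pi * |(j:ℝ)|) := by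
    intro a b
    rw [hI, norm_div, hn]
    gcongr
    refine (norm_sub_le _ _).trans ?_
    rw [norm_trigChar, norm_trigChar]; norm_num
  rw [dd_split]
  refine (norm_sub_le _ _).trans ((add_le_add (hb _ _) (hb _ _)).trans ?_)
  have hj' : 0 < |(j:ℝ)| := abs_pos.2 (by exact_mod_cast hj)
  have : 2 / (2 * Real.pi * |(j:ℝ)|) + 2 / (2 * Real.pi * |(j:ℝ)|) = (2 / Real.pi) * (1/|(j:ℝ)|) := by
    field_simp; norm_num
  rw [this]
  have : 2 / Real.pi ≤ 1 := by rw [div_le_one Real.pi_pos]; linarith [Real.pi_gt_three]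
  have h0 : 0 ≤ 1/|(j:ℝ)| := by positivity
  nlinarith

lemma sqw_memLp : MemLp (fun x => (sqw x : ℂ)) 2 (volume.restrict (Set.Ioc (0:ℝ) 1)) := by
  refine MemLp.of_bound (Complex.measurable_ofReal.comp sqw_measurable).aestronglyMeasurable 1
    (Filter.Eventually.of_forall ?_)
  intro x
  simp [sqw_abs]

lemma dd_hasSum : HasSum (fun i => ‖dd i‖ ^ 2) 1 := by
  have h := hasSum_sq_fourierCoeffOn zero_lt_one sqw_memLp
  simp only [fc_eq, sub_zero, inv_one, one_smul] at h
  have e : ∀ x : ℝ, ‖((sqw x : ℝ) : ℂ)‖ = 1 := fun x => by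
    rw [Complex.norm_real, Real.norm_eq_abs, sqw_abs]
  simp only [e] at h
  simpa [dd] using h

lemma dd_bessel (F : Finset ℤ) : ∑ j ∈ F, ‖dd j‖ ^ 2 ≤ 1 :=
  sum_le_hasSum F (fun _ _ => by positivity) dd_hasSum

noncomputable def Sp (K : ℕ) (x : ℝ) : ℂ := ∑ j ∈ Finset.Ioo (-(K:ℤ)) K, dd j * trigChar j x

lemma Sp_cont (K : ℕ) : Continuous (Sp K) :=
  continuous_finsetSum _ fun j _ => (continuous_trigChar j).const_mul _

lemma tail_hasSum (K : ℕ) :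
    HasSum (fun i => if i ∈ Finset.Ioo (-(K:ℤ)) K then 0 else ‖dd i‖ ^ 2)
      (∫ x in (0:ℝ)..1, ‖(sqw x : ℂ) - Sp K x‖ ^ 2) := by
  have hc := Sp_cont K
  have hm : MemLp (Sp K) 2 (volume.restrict (Set.Ioc (0:ℝ) 1)) := by
    refine MemLp.of_bound hc.aestronglyMeasurable (∑ j ∈ Finset.Ioo (-(K:ℤ)) K, ‖dd j‖)
      (Filter.Eventually.of_forall ?_)
    intro x
    refine (norm_sum_le _ _).trans (Finset.sum_le_sum fun j _ => ?_)
    rw [norm_mul, norm_trigChar, mul_one]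
  have h := hasSum_sq_fourierCoeffOn zero_lt_one (sqw_memLp.sub hm)
  simp only [fc_eq, sub_zero, inv_one, one_smul] at h
  have aux : ∀ i : ℤ, (if i ∈ Finset.Ioo (-(K:ℤ)) K then 0 else ‖dd i‖ ^ 2)
      = ‖fc ((fun x => (sqw x : ℂ)) - Sp K) i‖ ^ 2 := by
    intro i
    have : fc ((fun x => (sqw x : ℂ)) - Sp K) i = dd i - if i ∈ Finset.Ioo (-(K:ℤ)) K then dd i else 0 := by
      have e2 := fc_poly (Finset.Ioo (-(K:ℤ)) K) dd i
      rw [← e2]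
      unfold dd fc
      rw [← intervalIntegral.integral_sub]
      · congr 1; ext x; simp only [Pi.sub_apply, mul_sub]; rfl
      · refine ((continuous_trigChar (-i)).intervalIntegrable 0 1).mono_fun ?_ ?_
        · exact ((continuous_trigChar _).measurable.mul
            (Complex.measurable_ofReal.comp sqw_measurable)).aestronglyMeasurable
        · refine Filter.Eventually.of_forall fun x => ?_
          simp [sqw_abs]
      · exact ((continuous_trigChar (-i)).mul hc).intervalIntegrable 0 1
    rw [this]
    split_ifs <;> simp
  have e : (fun i => if i ∈ Finset.Ioo (-(K:ℤ)) K then 0 else ‖dd i‖ ^ 2)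
      = fun i => ‖fc ((fun x => (sqw x : ℂ)) - Sp K) i‖ ^ 2 := by
    ext i
    exact aux i
  rw [e]
  exact h

lemma tail_le (K : ℕ) (hK : 1 ≤ K) : ∫ x in (0:ℝ)..1, ‖(sqw x : ℂ) - Sp K x‖ ^ 2 ≤ 4 / K := by
  refine hasSum_le_of_sum_le (tail_hasSum K) fun F => ?_
  have hKr : (1:ℝ) ≤ K := by exact_mod_cast hK
  have hnat : ∀ n : ℕ, ∑ k ∈ Finset.Ico K (K + n), 1 / (k:ℝ)^2 ≤ 2 / K - 2 / ((K:ℝ) + n) := by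
    intro n
    induction n with
    | zero => simp
    | succ n ih =>
      rw [← add_assoc, Finset.sum_Ico_succ_top (by omega)]
      have h2 : 1 / (((K + n : ℕ):ℝ))^2 ≤ 2 / ((K:ℝ) + n) - 2 / ((K:ℝ) + n + 1) := by
        push_cast
        have hp : (1:ℝ) ≤ (K:ℝ) + n := by have : (0:ℝ) ≤ n := Nat.cast_nonneg n
                                          linarith
        generalize (K:ℝ) + n = y at hp
        rw [div_sub_div _ _ (by positivity) (by positivity), div_le_div_iff₀ (by positivity) (by positivity)]
        nlinarith
      push_cast at h2 ⊢
      rw [← add_assoc]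
      linarith
  set g : ℕ → ℝ := fun n => if n < K then 0 else 1 / (n:ℝ)^2 with hg
  have hg0 : ∀ n, 0 ≤ g n := fun n => by simp only [hg]; split_ifs <;> positivity
  have h1 : ∀ i : ℤ, (if i ∈ Finset.Ioo (-(K:ℤ)) K then 0 else ‖dd i‖ ^ 2) ≤ g i.natAbs := by
    intro i
    simp only [hg, Finset.mem_Ioo]
    by_cases hi : i.natAbs < K
    · rw [if_pos (by omega), if_pos hi]
    · rw [if_neg (by omega), if_neg hi]
      have hi0 : i ≠ 0 := by omega
      have := dd_bound i hi0
      have e : ((i.natAbs : ℕ) : ℝ) = |(i:ℝ)| := by simp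
      rw [e]
      calc ‖dd i‖^2 ≤ (1/|(i:ℝ)|)^2 := by gcongr
        _ = _ := by rw [div_pow, one_pow]
  refine (Finset.sum_le_sum fun i _ => h1 i).trans ?_
  rw [← Finset.sum_fiberwise_of_maps_to (g := Int.natAbs) (t := F.image Int.natAbs)
    (fun i hi => Finset.mem_image_of_mem _ hi)]
  have h3 : ∀ n ∈ F.image Int.natAbs, ∑ i ∈ F with i.natAbs = n, g i.natAbs ≤ 2 * g n := by
    intro n _
    have : ∑ i ∈ F with i.natAbs = n, g i.natAbs = ∑ i ∈ F with i.natAbs = n, g n :=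
      Finset.sum_congr rfl fun i hi => by rw [(Finset.mem_filter.1 hi).2]
    rw [this, Finset.sum_const, nsmul_eq_mul]
    have hcard : (F.filter (fun i => i.natAbs = n)).card ≤ 2 := by
      refine (Finset.card_le_card (t := {(n:ℤ), -(n:ℤ)}) ?_).trans Finset.card_le_two
      intro i hi
      have := (Finset.mem_filter.1 hi).2
      simp only [Finset.mem_insert, Finset.mem_singleton]; omega
    have : ((F.filter (fun i => i.natAbs = n)).card : ℝ) ≤ 2 := by exact_mod_cast hcard
    exact mul_le_mul_of_nonneg_right this (hg0 n)
  refine (Finset.sum_le_sum h3).trans ?_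
  rw [← Finset.mul_sum]
  obtain ⟨B, hB⟩ : ∃ B : ℕ, F.image Int.natAbs ⊆ Finset.range (K + B) := by
    refine ⟨(F.image Int.natAbs).sup id + 1, fun n hn => ?_⟩
    have : n ≤ (F.image Int.natAbs).sup id := Finset.le_sup (f := id) hn
    rw [Finset.mem_range]; omega
  have h4 : ∑ n ∈ F.image Int.natAbs, g n ≤ ∑ n ∈ Finset.range (K + B), g n :=
    Finset.sum_le_sum_of_subset_of_nonneg hB fun n _ _ => hg0 n
  have h5 : ∑ n ∈ Finset.range (K + B), g n = ∑ n ∈ Finset.Ico K (K + B), 1 / (n:ℝ)^2 := by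
    rw [Finset.range_eq_Ico, ← Finset.sum_Ico_consecutive _ (Nat.zero_le K) (Nat.le_add_right K B)]
    have : ∑ n ∈ Finset.Ico 0 K, g n = 0 := Finset.sum_eq_zero fun n hn => by
      simp only [hg]; rw [if_pos (Finset.mem_Ico.1 hn).2]
    rw [this, zero_add]
    exact Finset.sum_congr rfl fun n hn => by
      simp only [hg]; rw [if_neg (not_lt.2 (Finset.mem_Ico.1 hn).1)]
  have h6 := hnat B
  have h7 : 0 ≤ 2 / ((K:ℝ) + B) := by positivity
  have h8 : (4:ℝ) / K = 2 * (2 / K) := by ring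
  rw [h8]; linarith

def lev (j : ℤ) : ℕ := if j = 0 then 0 else Nat.log 256 j.natAbs + 1

lemma lev_le_iff (j : ℤ) (l : ℕ) : lev j ≤ l ↔ j.natAbs < 256 ^ l := by
  unfold lev
  split_ifs with h
  · subst h; simp
  · rw [Nat.succ_le_iff]
    exact (Nat.log_lt_iff_lt_pow (by norm_num) (by simpa using h))

lemma lev_zero_iff (j : ℤ) : lev j = 0 ↔ j = 0 := by
  unfold lev; split_ifs with h <;> simp [h]

noncomputable def box (T : ℕ) : Finset ℤ := Finset.Ioo (-((256 ^ T : ℕ) : ℤ)) ((256 ^ T : ℕ) : ℤ)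

lemma mem_box (T : ℕ) (j : ℤ) : j ∈ box T ↔ lev j ≤ T := by
  rw [lev_le_iff, box, Finset.mem_Ioo]
  generalize 256 ^ T = K
  omega

noncomputable def blk (l : ℕ) : Finset ℤ := (box l).filter (fun j => lev j = l)

lemma mem_blk (l : ℕ) (j : ℤ) : j ∈ blk l ↔ lev j = l := by
  rw [blk, Finset.mem_filter, mem_box]; constructor
  · exact fun h => h.2
  · exact fun h => ⟨h.le, h⟩

lemma sum_box {E : Type*} [AddCommMonoid E] (T : ℕ) (f : ℤ → E) :
    ∑ j ∈ box T, f j = ∑ l ∈ Finset.range (T + 1), ∑ j ∈ blk l, f j := by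
  rw [← Finset.sum_fiberwise_of_maps_to (g := lev) (t := Finset.range (T + 1))
    (fun i hi => by rw [Finset.mem_range]; have := (mem_box _ _).1 hi; omega)]
  refine Finset.sum_congr rfl fun l hl => ?_
  refine Finset.sum_congr ?_ fun _ _ => rfl
  ext j
  rw [Finset.mem_filter, mem_box, mem_blk]
  have := Finset.mem_range.1 hl
  constructor
  · exact fun h => h.2
  · intro h; exact ⟨by omega, h⟩

lemma blk_card (l : ℕ) : (blk l).card ≤ 2 * 256 ^ l := by
  refine (Finset.card_filter_le _ _).trans ?_
  rw [box, Int.card_Ioo]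
  generalize 256 ^ l = K
  omega

noncomputable def DD (T l : ℕ) (x : ℝ) : ℂ :=
  if l ≤ T then ∑ j ∈ blk l, dd j * trigChar j x else (sqw x : ℂ) - Sp (256 ^ T) x

lemma DD_zero (T : ℕ) (x : ℝ) : DD T 0 x = 0 := by
  unfold DD
  rw [if_pos (Nat.zero_le _)]
  refine Finset.sum_eq_zero fun j hj => ?_
  rw [mem_blk, lev_zero_iff] at hj
  rw [hj, dd_zero, zero_mul]

lemma DD_sum (T : ℕ) (x : ℝ) : ∑ l ∈ Finset.range (T + 2), DD T l x = (sqw x : ℂ) := by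
  rw [Finset.sum_range_succ]
  have h1 : ∑ l ∈ Finset.range (T + 1), DD T l x = Sp (256 ^ T) x := by
    rw [Sp]
    change _ = ∑ j ∈ box T, _
    rw [sum_box]
    refine Finset.sum_congr rfl fun l hl => ?_
    have := Finset.mem_range.1 hl
    rw [DD, if_pos (by omega)]
  rw [h1, DD, if_neg (by omega)]
  ring

lemma DD_meas (T l : ℕ) : Measurable (DD T l) := by
  by_cases h : l ≤ T
  · have : DD T l = fun x => ∑ j ∈ blk l, dd j * trigChar j x := by ext x; simp [DD, h]
    rw [this]
    exact (continuous_finsetSum _ fun j _ => (continuous_trigChar j).const_mul _).measurable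
  · have : DD T l = fun x => (sqw x : ℂ) - Sp (256 ^ T) x := by ext x; simp [DD, h]
    rw [this]
    exact (Complex.measurable_ofReal.comp sqw_measurable).sub (Sp_cont _).measurable

lemma DD_bdd (T l : ℕ) : ∃ C, ∀ x, ‖DD T l x‖ ≤ C := by
  have hp : ∀ (F : Finset ℤ) (x : ℝ), ‖∑ j ∈ F, dd j * trigChar j x‖ ≤ ∑ j ∈ F, ‖dd j‖ := by
    intro F x
    refine (norm_sum_le _ _).trans (Finset.sum_le_sum fun j _ => ?_)
    rw [norm_mul, norm_trigChar, mul_one]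
  by_cases h : l ≤ T
  · refine ⟨∑ j ∈ blk l, ‖dd j‖, fun x => ?_⟩
    rw [DD, if_pos h]; exact hp _ _
  · refine ⟨1 + ∑ j ∈ box T, ‖dd j‖, fun x => ?_⟩
    rw [DD, if_neg h]
    refine (norm_sub_le _ _).trans (add_le_add ?_ (hp _ _))
    rw [Complex.norm_real, Real.norm_eq_abs, sqw_abs]

lemma DD_periodic (T l : ℕ) : Function.Periodic (DD T l) 1 := by
  intro x
  have hp : ∀ (F : Finset ℤ), ∑ j ∈ F, dd j * trigChar j (x + 1) = ∑ j ∈ F, dd j * trigChar j x :=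
    fun F => Finset.sum_congr rfl fun j _ => by rw [trigChar_periodic j x]
  unfold DD Sp
  rw [hp, hp, sqw_periodic x]

lemma DD_norm (T l : ℕ) (h1 : 1 ≤ l) (h2 : l ≤ T + 1) :
    ∫ x in (0:ℝ)..1, ‖DD T l x‖ ^ 2 ≤ 1024 / 256 ^ l := by
  obtain ⟨k, rfl⟩ : ∃ k, l = k + 1 := ⟨l - 1, by omega⟩
  have e : (1024:ℝ) / 256 ^ (k + 1) = 4 / ((256 ^ k : ℕ) : ℝ) := by
    push_cast; rw [pow_succ]; field_simp; norm_num
  have hk := tail_le (256 ^ k) (Nat.one_le_pow _ _ (by norm_num))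
  rw [e]
  by_cases h : k + 1 ≤ T
  · simp only [DD, if_pos h]
    rw [poly_norm]
    refine le_trans ?_ hk
    have := sum_le_hasSum (blk (k+1)) (fun i _ => by split_ifs <;> positivity) (tail_hasSum (256 ^ k))
    refine le_trans (le_of_eq ?_) this
    refine Finset.sum_congr rfl fun j hj => ?_
    rw [mem_blk] at hj
    have : j ∉ box k := by rw [mem_box]; omega
    rw [box] at this
    rw [if_neg this]
  · have : k = T := by omega
    subst this
    simp only [DD, if_neg h]
    exact hk

lemma integral_dilate (f : ℝ → ℝ) (hf : Function.Periodic f 1) (hm : Measurable f)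
    (C : ℝ) (hb : ∀ x, |f x| ≤ C) (m : ℕ) (hm1 : 1 ≤ m) :
    ∫ x in (0:ℝ)..1, f (m * x) = ∫ x in (0:ℝ)..1, f x := by
  have hm0 : (m:ℝ) ≠ 0 := by positivity
  rw [intervalIntegral.integral_comp_mul_left _ hm0]
  have hint : ∀ a b, IntervalIntegrable f volume a b := by
    intro a b
    refine (intervalIntegrable_const (c := C)).mono_fun hm.aestronglyMeasurable
      (Filter.Eventually.of_forall fun x => ?_)
    simp only [Real.norm_eq_abs]
    exact (hb x).trans (le_abs_self _)
  have := hf.intervalIntegral_add_zsmul_eq m 0 hint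
  simp only [zero_add, zsmul_eq_mul, mul_one, Int.cast_natCast, mul_zero] at this ⊢
  rw [this, smul_eq_mul, ← mul_assoc, inv_mul_cancel₀ hm0, one_mul]

lemma good_set (T R : ℕ) (hR : 1 ≤ R) : ∃ G : Set ℝ, MeasurableSet G ∧ G ⊆ Set.Ioc 0 1 ∧
    3/4 ≤ (volume.restrict (Set.Ioc (0:ℝ) 1)).real G ∧ ∀ x ∈ G, ∀ l, 1 ≤ l → l ≤ T + 1 →
    ∑ m : Fin R, ‖DD T l (((m : ℕ) + 1 : ℕ) * x)‖ ^ 2 ≤ R * (4096 / 16 ^ l) := by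
  set μ := volume.restrict (Set.Ioc (0:ℝ) 1) with hμ
  have : IsProbabilityMeasure μ := ⟨by simp [hμ]⟩
  have hR' : (0:ℝ) < R := by positivity
  set F : ℕ → ℝ → ℝ := fun l x => ∑ m : Fin R, ‖DD T l (((m : ℕ) + 1 : ℕ) * x)‖ ^ 2 with hF
  have hFm : ∀ l, Measurable (F l) := fun l => by
    refine Finset.measurable_fun_sum _ fun m _ => ?_
    exact (((DD_meas T l).comp (measurable_const.mul measurable_id)).norm).pow_const 2
  have hFi : ∀ l, ∀ m : ℕ, Integrable (fun x => ‖DD T l ((m + 1 : ℕ) * x)‖ ^ 2) μ := fun l m => by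
    obtain ⟨C, hC⟩ := DD_bdd T l
    refine Integrable.of_bound
      ((((DD_meas T l).comp (measurable_const.mul measurable_id)).norm).pow_const 2).aestronglyMeasurable
      (C ^ 2) (Filter.Eventually.of_forall fun x => ?_)
    rw [norm_pow, norm_norm]
    have := hC ((m + 1 : ℕ) * x)
    gcongr
  set B : ℕ → Set ℝ := fun l => {x | R * (4096 / 16 ^ l) ≤ F l x} with hB
  have hBm : ∀ l, MeasurableSet (B l) := fun l => measurableSet_le measurable_const (hFm l)
  have hBμ : ∀ l, 1 ≤ l → l ≤ T + 1 → μ.real (B l) ≤ 1 / 4 / 16 ^ l := by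
    intro l h1 h2
    have hM := mul_meas_ge_le_integral_of_nonneg (μ := μ) (f := F l)
      (Filter.Eventually.of_forall fun x => Finset.sum_nonneg fun m _ => by positivity)
      (integrable_finsetSum _ fun m _ => hFi l m) (R * (4096 / 16 ^ l))
    have hI : ∫ x, F l x ∂μ ≤ R * (1024 / 256 ^ l) := by
      simp only [hF]
      rw [integral_finsetSum _ fun (m : Fin R) _ => hFi l m]
      have : ∀ m : Fin R, ∫ x, ‖DD T l (((m : ℕ) + 1 : ℕ) * x)‖ ^ 2 ∂μ ≤ 1024 / 256 ^ l := by
        intro m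
        rw [hμ, ← intervalIntegral.integral_of_le zero_le_one]
        obtain ⟨C, hC⟩ := DD_bdd T l
        rw [integral_dilate (fun x => ‖DD T l x‖ ^ 2)
          (fun x => by simp only [DD_periodic T l x]) (((DD_meas T l).norm).pow_const 2) (C ^ 2) ?_ _
          (by omega)]
        · exact DD_norm T l h1 h2
        · intro x
          rw [abs_pow, abs_norm]
          have := hC x
          gcongr
      refine (Finset.sum_le_sum fun m _ => this m).trans ?_
      simp
    have h3 : R * (4096 / 16 ^ l) * μ.real (B l) ≤ R * (1024 / 256 ^ l) := hM.trans hI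
    have h4 : (256:ℝ) ^ l = 16 ^ l * 16 ^ l := by rw [← mul_pow]; norm_num
    rw [h4] at h3
    have h16 : (0:ℝ) < 16 ^ l := by positivity
    generalize (16:ℝ) ^ l = z at *
    rw [le_div_iff₀ h16]
    have h5 : R * (4096 / z) * μ.real (B l) = (R * 4096 / z^2) * (μ.real (B l) * z) := by field_simp
    have h6 : R * (1024 / (z * z)) = (R * 4096 / z^2) * (1/4) := by field_simp; norm_num
    rw [h5, h6] at h3
    exact le_of_mul_le_mul_left h3 (by positivity)
  set U : Set ℝ := ⋃ l ∈ Finset.Icc 1 (T + 1), B l with hU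
  have hUm : MeasurableSet U := Finset.measurableSet_biUnion _ fun l _ => hBm l
  have hUμ : μ.real U ≤ 1 / 4 := by
    refine (measureReal_biUnion_finset_le _ _).trans ?_
    have : ∀ n : ℕ, ∑ l ∈ Finset.Icc 1 n, (1:ℝ) / 4 / 16 ^ l ≤ 1/4 - 1/4/16^n := by
      intro n
      induction n with
      | zero => simp
      | succ n ih =>
        rw [Finset.sum_Icc_succ_top (by omega)]
        have h0 : (0:ℝ) < 1/4/16^n := by positivity
        have : (1:ℝ)/4/16^(n+1) = 1/16 * (1/4/16^n) := by rw [pow_succ]; field_simp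
        rw [this]; linarith
    have h2 := this (T + 1)
    have h0 : (0:ℝ) < 1/4/16^(T+1) := by positivity
    refine (Finset.sum_le_sum fun l hl => hBμ l (Finset.mem_Icc.1 hl).1 (Finset.mem_Icc.1 hl).2).trans ?_
    linarith
  refine ⟨Set.Ioc 0 1 \ U, measurableSet_Ioc.diff hUm, Set.sdiff_subset, ?_, ?_⟩
  · have h1 : μ.real (Set.Ioc 0 1 \ U) = μ.real (Uᶜ) := by
      simp only [hμ, measureReal_def]
      rw [Measure.restrict_apply (measurableSet_Ioc.diff hUm), Measure.restrict_apply hUm.compl]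
      congr 2; ext x; simp only [Set.mem_inter_iff, Set.mem_sdiff, Set.mem_compl_iff]; tauto
    rw [h1, probReal_compl_eq_one_sub hUm]
    linarith
  · intro x hx l h1 h2
    by_contra hcon
    apply hx.2
    simp only [hU, Set.mem_iUnion]
    exact ⟨l, Finset.mem_Icc.2 ⟨h1, h2⟩, (not_le.1 hcon).le⟩

noncomputable def coef (A B : ℝ) (j : ℤ) : ℂ := if j = 0 then (A : ℂ) else (B : ℂ) * dd j

noncomputable def Del (T : ℕ) (A B : ℝ) (l : ℕ) (y : ℝ) : ℂ :=
  if l = 0 then (A : ℂ) else (B : ℂ) * DD T l y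

lemma Del_sum (T : ℕ) (A B : ℝ) (y : ℝ) :
    ∑ l ∈ Finset.range (T + 2), Del T A B l y = ((A + B * sqw y : ℝ) : ℂ) := by
  have : ∀ l, Del T A B l y = (if l = 0 then (A:ℂ) else 0) + (B:ℂ) * DD T l y := by
    intro l; unfold Del; split_ifs with h
    · subst h; rw [DD_zero]; simp
    · simp
  simp_rw [this]
  rw [Finset.sum_add_distrib, ← Finset.mul_sum, DD_sum]
  simp

lemma Del_eq (T : ℕ) (A B : ℝ) (l : ℕ) (hl : l ≤ T) (y : ℝ) :
    Del T A B l y = ∑ j ∈ blk l, coef A B j * trigChar j y := by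
  unfold Del
  split_ifs with h
  · subst h
    have : blk 0 = {0} := by ext j; rw [mem_blk, lev_zero_iff, Finset.mem_singleton]
    rw [this]; simp [coef, trigChar_zero]
  · rw [DD, if_pos hl, Finset.mul_sum]
    refine Finset.sum_congr rfl fun j hj => ?_
    have : j ≠ 0 := by
      intro h0; subst h0; rw [mem_blk] at hj; exact h (by rw [← hj]; simp [lev])
    simp [coef, this, mul_assoc]

noncomputable def cross (n T : ℕ) : Finset (Fin n → ℤ) :=
  (Fintype.piFinset fun _ : Fin n => box T).filter (fun j => ∑ a, lev (j a) ≤ T)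

lemma mem_cross (n T : ℕ) (j : Fin n → ℤ) : j ∈ cross n T ↔ ∑ a, lev (j a) ≤ T := by
  rw [cross, Finset.mem_filter, Fintype.mem_piFinset]
  constructor
  · exact fun h => h.2
  · refine fun h => ⟨fun a => ?_, h⟩
    rw [mem_box]
    exact (Finset.single_le_sum (f := fun a => lev (j a)) (fun _ _ => Nat.zero_le _)
      (Finset.mem_univ a)).trans h

noncomputable def Ht {n : ℕ} (T : ℕ) (A B : Fin n → ℝ) (y : Fin n → ℝ) : ℂ :=
  ∑ j ∈ cross n T, ∏ a, (coef (A a) (B a) (j a) * trigChar (j a) (y a))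

lemma Ht_eq {n : ℕ} (T : ℕ) (A B : Fin n → ℝ) (y : Fin n → ℝ) :
    Ht T A B y = ∑ l ∈ (Fintype.piFinset fun _ : Fin n => Finset.range (T + 2)) with ∑ a, l a ≤ T,
      ∏ a, Del T (A a) (B a) (l a) (y a) := by
  unfold Ht
  rw [← Finset.sum_fiberwise_of_maps_to (g := fun (j : Fin n → ℤ) a => lev (j a))
    (t := (Fintype.piFinset fun _ : Fin n => Finset.range (T + 2)).filter (fun l => ∑ a, l a ≤ T))]
  · refine Finset.sum_congr rfl fun l hl => ?_
    rw [Finset.mem_filter, Fintype.mem_piFinset] at hl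
    have hla : ∀ a, l a ≤ T := fun a =>
      (Finset.single_le_sum (f := l) (fun _ _ => Nat.zero_le _) (Finset.mem_univ a)).trans hl.2
    have : ∀ a, Del T (A a) (B a) (l a) (y a)
        = ∑ j ∈ blk (l a), coef (A a) (B a) j * trigChar j (y a) := fun a => Del_eq _ _ _ _ (hla a) _
    simp_rw [this]
    rw [Finset.prod_univ_sum]
    refine Finset.sum_congr ?_ fun _ _ => rfl
    ext j
    rw [Finset.mem_filter, mem_cross, Fintype.mem_piFinset]
    simp_rw [mem_blk]
    constructor
    · intro h a; exact congrFun h.2 a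
    · intro h
      refine ⟨?_, funext h⟩
      simp_rw [h]; exact hl.2
  · intro j hj
    rw [mem_cross] at hj
    rw [Finset.mem_filter, Fintype.mem_piFinset]
    refine ⟨fun a => ?_, hj⟩
    have := (Finset.single_le_sum (f := fun a => lev (j a)) (fun _ _ => Nat.zero_le _)
      (Finset.mem_univ a)).trans hj
    rw [Finset.mem_range]; omega

lemma H_sub_Ht {n : ℕ} (T : ℕ) (A B : Fin n → ℝ) (y : Fin n → ℝ) :
    ((∏ a, (A a + B a * sqw (y a)) : ℝ) : ℂ) - Ht T A B y
     = ∑ l ∈ (Fintype.piFinset fun _ : Fin n => Finset.range (T + 2)) with ¬ (∑ a, l a ≤ T),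
      ∏ a, Del T (A a) (B a) (l a) (y a) := by
  rw [Ht_eq]
  rw [Complex.ofReal_prod]
  simp_rw [← Del_sum T]
  rw [Finset.prod_univ_sum, ← Finset.sum_filter_add_sum_filter_not
    (Fintype.piFinset fun _ : Fin n => Finset.range (T + 2)) (fun l => ∑ a, l a ≤ T),
    add_sub_cancel_left]

lemma avg_prod {V : Type*} [Fintype V] [DecidableEq V] {n : ℕ} (R : ℕ) (q : Fin n → V) (hq : Function.Injective q)
    (f : Fin n → Fin R → ℝ) (hf : ∀ a m, 0 ≤ f a m) (c : Fin n → ℝ)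
    (hc : ∀ a, ∑ m, f a m ≤ R * c a) :
    ∑ M : V → Fin R, ∏ a, f a (M (q a)) ≤ (R:ℝ) ^ (Fintype.card V) * ∏ a, c a := by
  set F : V → Fin R → ℝ := Function.extend q f (fun _ _ => 1) with hF
  set C : V → ℝ := Function.extend q c (fun _ => 1) with hC
  have h1 : ∀ M : V → Fin R, ∏ a, f a (M (q a)) = ∏ v, F v (M v) := by
    intro M
    refine Fintype.prod_of_injective q hq _ _ ?_ ?_
    · intro v hv
      simp only [hF]
      rw [Function.extend_apply' _ _ _ (by simpa using hv)]
    · intro a; simp only [hF]; rw [hq.extend_apply]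
  have h2 : ∏ a, c a = ∏ v, C v := by
    refine Fintype.prod_of_injective q hq _ _ ?_ ?_
    · intro v hv
      simp only [hC]
      rw [Function.extend_apply' _ _ _ (by simpa using hv)]
    · intro a; simp only [hC]; rw [hq.extend_apply]
  simp_rw [h1]
  rw [h2, ← Finset.card_univ, ← Finset.prod_const, ← Finset.prod_mul_distrib]
  have h3 := Finset.prod_univ_sum (fun _ : V => (Finset.univ : Finset (Fin R))) F
  rw [Fintype.piFinset_univ] at h3
  rw [← h3]
  refine Finset.prod_le_prod ?_ ?_
  · intro v _
    refine Finset.sum_nonneg fun m _ => ?_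
    by_cases hv : ∃ a, q a = v
    · obtain ⟨a, rfl⟩ := hv
      simp only [hF]; rw [hq.extend_apply]; exact hf a m
    · simp only [hF]; rw [Function.extend_apply' _ _ _ hv]; norm_num
  · intro v _
    by_cases hv : ∃ a, q a = v
    · obtain ⟨a, rfl⟩ := hv
      simp only [hF, hC]; rw [hq.extend_apply, hq.extend_apply]; exact hc a
    · simp only [hF, hC]; rw [Function.extend_apply' _ _ _ hv, Function.extend_apply' _ _ _ hv]; simp

lemma err_avg {V : Type*} [Fintype V] [DecidableEq V] {n : ℕ} (T R : ℕ)
    (q : Fin n → V) (hq : Function.Injective q)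
    (A B : Fin n → ℝ) (hA : ∀ a, |A a| ≤ 1) (hB : ∀ a, |B a| ≤ 1) (x : ℝ)
    (hx : ∀ l, 1 ≤ l → l ≤ T + 1 →
      ∑ m : Fin R, ‖DD T l (((m : ℕ) + 1 : ℕ) * x)‖ ^ 2 ≤ R * (4096 / 16 ^ l)) :
    ∑ M : V → Fin R, ‖((∏ a, (A a + B a * sqw (((M (q a) : ℕ) + 1 : ℕ) * x)) : ℝ) : ℂ)
      - Ht T A B (fun a => ((M (q a) : ℕ) + 1 : ℕ) * x)‖
    ≤ (R:ℝ) ^ (Fintype.card V) * (128 ^ n / 2 ^ T) := by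
  have hDel : ∀ a, ∀ l ≤ T + 1, ∑ m : Fin R, ‖Del T (A a) (B a) l (((m : ℕ) + 1 : ℕ) * x)‖
      ≤ R * (64 / 4 ^ l) := by
    intro a l hl
    by_cases h0 : l = 0
    · subst h0
      simp only [Del, if_true, Complex.norm_real, Real.norm_eq_abs, Finset.sum_const, Finset.card_univ,
        Fintype.card_fin, nsmul_eq_mul, pow_zero, div_one]
      gcongr
      linarith [hA a]
    · have h1 : ∀ m : Fin R, ‖Del T (A a) (B a) l (((m : ℕ) + 1 : ℕ) * x)‖
          ≤ ‖DD T l (((m : ℕ) + 1 : ℕ) * x)‖ := by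
        intro m
        rw [Del, if_neg h0, norm_mul, Complex.norm_real, Real.norm_eq_abs]
        exact mul_le_of_le_one_left (norm_nonneg _) (hB a)
      refine (Finset.sum_le_sum fun m _ => h1 m).trans ?_
      refine abs_le_of_sq_le_sq' ?_ (by positivity) |>.2
      refine (sq_sum_le_card_mul_sum_sq).trans ?_
      rw [Finset.card_univ, Fintype.card_fin]
      calc (R:ℝ) * ∑ m : Fin R, ‖DD T l (((m : ℕ) + 1 : ℕ) * x)‖ ^ 2
          ≤ R * (R * (4096 / 16 ^ l)) := by gcongr; exact hx l (by omega) hl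
        _ = (R * (64 / 4 ^ l)) ^ 2 := by
          have : (16:ℝ) ^ l = 4 ^ l * 4 ^ l := by rw [← mul_pow]; norm_num
          rw [this]; field_simp; norm_num
  set S := (Fintype.piFinset fun _ : Fin n => Finset.range (T + 2)).filter (fun l => ¬ (∑ a, l a ≤ T))
    with hS
  calc _ ≤ ∑ M : V → Fin R, ∑ l ∈ S, ∏ a, ‖Del T (A a) (B a) (l a) (((M (q a) : ℕ) + 1 : ℕ) * x)‖ := by
        refine Finset.sum_le_sum fun M _ => ?_
        rw [H_sub_Ht]
        refine (norm_sum_le _ _).trans (le_of_eq ?_)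
        exact Finset.sum_congr rfl fun l _ => norm_prod _ _
    _ = ∑ l ∈ S, ∑ M : V → Fin R, ∏ a, ‖Del T (A a) (B a) (l a) (((M (q a) : ℕ) + 1 : ℕ) * x)‖ :=
        Finset.sum_comm
    _ ≤ ∑ l ∈ S, (R:ℝ) ^ (Fintype.card V) * ∏ a, (64 / 4 ^ (l a) : ℝ) := by
        refine Finset.sum_le_sum fun l hl => ?_
        rw [hS, Finset.mem_filter, Fintype.mem_piFinset] at hl
        refine avg_prod R q hq
          (fun a m => ‖Del T (A a) (B a) (l a) (((m : ℕ) + 1 : ℕ) * x)‖) (fun _ _ => norm_nonneg _) _ ?_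
        intro a
        have := Finset.mem_range.1 (hl.1 a)
        exact hDel a (l a) (by omega)
    _ = (R:ℝ) ^ (Fintype.card V) * ∑ l ∈ S, ∏ a, (64 / 4 ^ (l a) : ℝ) := by rw [Finset.mul_sum]
    _ ≤ (R:ℝ) ^ (Fintype.card V) * (128 ^ n / 2 ^ T) := by
        gcongr
        calc ∑ l ∈ S, ∏ a, (64 / 4 ^ (l a) : ℝ) ≤ ∑ l ∈ S, (1 / 2 ^ T) * ∏ a, (64 / 2 ^ (l a) : ℝ) := by
              refine Finset.sum_le_sum fun l hl => ?_
              rw [hS, Finset.mem_filter] at hl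
              have e : ∏ a, (64 / 4 ^ (l a) : ℝ) = (1 / 2 ^ (∑ a, l a)) * ∏ a, (64 / 2 ^ (l a) : ℝ) := by
                rw [← Finset.prod_pow_eq_pow_sum, one_div, ← Finset.prod_inv_distrib,
                  ← Finset.prod_mul_distrib]
                refine Finset.prod_congr rfl fun a _ => ?_
                have : (4:ℝ) ^ l a = 2 ^ l a * 2 ^ l a := by rw [← mul_pow]; norm_num
                rw [this]; field_simp
              rw [e]
              gcongr
              · norm_num
              · omega
          _ ≤ ∑ l ∈ Fintype.piFinset fun _ : Fin n => Finset.range (T + 2),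
                (1 / 2 ^ T) * ∏ a, (64 / 2 ^ (l a) : ℝ) :=
              Finset.sum_le_sum_of_subset_of_nonneg (Finset.filter_subset _ _)
                fun _ _ _ => by positivity
          _ = (1 / 2 ^ T) * ∏ _a : Fin n, ∑ l ∈ Finset.range (T + 2), (64 / 2 ^ l : ℝ) := by
              rw [← Finset.mul_sum, Finset.prod_univ_sum]
          _ ≤ (1 / 2 ^ T) * ∏ _a : Fin n, (128:ℝ) := by
              gcongr with a _
              have : ∀ k : ℕ, ∑ l ∈ Finset.range k, (64 / 2 ^ l : ℝ) = 128 - 128 / 2 ^ k := by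
                intro k
                induction k with
                | zero => simp
                | succ k ih => rw [Finset.sum_range_succ, ih, pow_succ]; field_simp; ring
              rw [this]
              have : (0:ℝ) < 128 / 2 ^ (T+2) := by positivity
              linarith
          _ = 128 ^ n / 2 ^ T := by simp; ring

lemma cross_card (n T : ℕ) : (cross n T).card ≤ 2 ^ (16 * T) * 4 ^ n := by
  have h : ((cross n T).card : ℝ) ≤ 2 ^ (16 * T) * 4 ^ n := by
    calc ((cross n T).card : ℝ) = ∑ j ∈ cross n T, 1 := by simp
      _ ≤ ∑ j ∈ cross n T, (65536:ℝ) ^ T * ∏ a, (1 / 65536 ^ (lev (j a)) : ℝ) := by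
        refine Finset.sum_le_sum fun j hj => ?_
        rw [mem_cross] at hj
        simp_rw [one_div]
        rw [Finset.prod_inv_distrib, Finset.prod_pow_eq_pow_sum, ← div_eq_mul_inv, le_div_iff₀ (by positivity), one_mul]
        exact pow_le_pow_right₀ (by norm_num) hj
      _ ≤ ∑ j ∈ Fintype.piFinset fun _ : Fin n => box T, (65536:ℝ) ^ T * ∏ a, (1 / 65536 ^ (lev (j a)) : ℝ) :=
        Finset.sum_le_sum_of_subset_of_nonneg (Finset.filter_subset _ _)
                fun _ _ _ => by positivity
      _ = 65536 ^ T * ∏ _a : Fin n, ∑ j ∈ box T, (1 / 65536 ^ (lev j) : ℝ) := by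
        rw [← Finset.mul_sum, Finset.prod_univ_sum]
      _ ≤ 65536 ^ T * ∏ _a : Fin n, (4:ℝ) := by
        gcongr with a _
        rw [sum_box]
        have h1 : ∀ l, ∑ j ∈ blk l, (1 / 65536 ^ (lev j) : ℝ) ≤ 2 / 256 ^ l := by
          intro l
          have : ∑ j ∈ blk l, (1 / 65536 ^ (lev j) : ℝ) = ∑ j ∈ blk l, (1 / 65536 ^ l : ℝ) :=
            Finset.sum_congr rfl fun j hj => by rw [(mem_blk l j).1 hj]
          rw [this, Finset.sum_const, nsmul_eq_mul]
          have hc : ((blk l).card : ℝ) ≤ 2 * 256 ^ l := by exact_mod_cast blk_card l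
          calc ((blk l).card : ℝ) * (1 / 65536 ^ l) ≤ (2 * 256 ^ l) * (1 / 65536 ^ l) := by gcongr
            _ = 2 / 256 ^ l := by
              have : (65536:ℝ) ^ l = 256 ^ l * 256 ^ l := by rw [← mul_pow]; norm_num
              rw [this]; field_simp
        refine (Finset.sum_le_sum fun l _ => h1 l).trans ?_
        have : ∀ k : ℕ, ∑ l ∈ Finset.range k, (2 / 256 ^ l : ℝ) ≤ 4 - 4 / 256 ^ k := by
          intro k
          induction k with
          | zero => simp
          | succ k ih =>
            rw [Finset.sum_range_succ]
            have h0 : (0:ℝ) < 1 / 256 ^ k := by positivity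
            have e1 : (2:ℝ) / 256 ^ k = 2 * (1 / 256 ^ k) := by ring
            have e2 : (4:ℝ) / 256 ^ k = 4 * (1 / 256 ^ k) := by ring
            have e3 : (4:ℝ) / 256 ^ (k + 1) = 4 / 256 * (1 / 256 ^ k) := by rw [pow_succ]; field_simp
            rw [e2] at ih; rw [e1, e3]; linarith
        have h2 := this (T + 1)
        have : (0:ℝ) < 4 / 256 ^ (T+1) := by positivity
        linarith
      _ = 2 ^ (16 * T) * 4 ^ n := by rw [pow_mul]; norm_num
  exact_mod_cast h

lemma coef_l2 {n : ℕ} (T : ℕ) (A B : Fin n → ℝ) :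
    ∑ j ∈ cross n T, ∏ a, ‖coef (A a) (B a) (j a)‖ ^ 2 ≤ ∏ a, (A a ^ 2 + B a ^ 2) := by
  calc _ ≤ ∑ j ∈ Fintype.piFinset fun _ : Fin n => box T, ∏ a, ‖coef (A a) (B a) (j a)‖ ^ 2 :=
        Finset.sum_le_sum_of_subset_of_nonneg (Finset.filter_subset _ _)
                fun _ _ _ => by positivity
    _ = ∏ a, ∑ j ∈ box T, ‖coef (A a) (B a) j‖ ^ 2 := by
        rw [Finset.prod_univ_sum]
    _ ≤ _ := by
        refine Finset.prod_le_prod (fun _ _ => by positivity) fun a _ => ?_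
        have : ∀ j, ‖coef (A a) (B a) j‖ ^ 2 ≤ (if j = 0 then A a ^ 2 else 0) + B a ^ 2 * ‖dd j‖ ^ 2 := by
          intro j; unfold coef; split_ifs with h
          · rw [Complex.norm_real, Real.norm_eq_abs, sq_abs]
            have : 0 ≤ B a ^ 2 * ‖dd j‖ ^ 2 := by positivity
            linarith
          · rw [norm_mul, Complex.norm_real, Real.norm_eq_abs, mul_pow, sq_abs, zero_add]
        refine (Finset.sum_le_sum fun j _ => this j).trans ?_
        rw [Finset.sum_add_distrib, ← Finset.mul_sum]
        refine add_le_add ?_ ?_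
        · rw [Finset.sum_ite_eq']; split_ifs
          · exact le_rfl
          · positivity
        · exact mul_le_of_le_one_right (by positivity) (dd_bessel _)

def tpath (s : ℕ → ℕ → ℝ) [∀ a b, Decidable (s a b = 1)] : ℕ → ℕ
  | 0 => 0
  | k + 1 => 2 * tpath s k + if s k (tpath s k) = 1 then 1 else 0

noncomputable def cA (k a : ℕ) : ℝ := if a < k then 1/2 else if a = k then 0 else 1

noncomputable def cB (k i a : ℕ) : ℝ :=
  if a < k then (if (i / 2 ^ (k - a - 1)) % 2 = 1 then 1/2 else -1/2) else if a = k then 1 else 0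

def tkey (n k i : ℕ) : ℕ := (2 * i + 1) * 2 ^ (n - k - 1)

open Classical in
lemma tree_prod (s : ℕ → ℕ → ℝ) (hs : ∀ a b, s a b = 1 ∨ s a b = -1) (k : ℕ) :
    ∀ i < 2 ^ k, ∏ a ∈ Finset.range k,
      (1/2 + (if (i / 2 ^ (k - a - 1)) % 2 = 1 then 1/2 else -1/2) * s a (i / 2 ^ (k - a)))
      = if i = tpath s k then 1 else 0 := by
  induction k with
  | zero =>
    intro i hi
    have : i = 0 := by simpa using hi
    simp [tpath, this]
  | succ k ih =>
    intro i hik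
    rw [Finset.prod_range_succ]
    have e : ∏ a ∈ Finset.range k,
        (1/2 + (if (i / 2 ^ (k + 1 - a - 1)) % 2 = 1 then 1/2 else -1/2) * s a (i / 2 ^ (k + 1 - a)))
        = ∏ a ∈ Finset.range k,
        (1/2 + (if ((i/2) / 2 ^ (k - a - 1)) % 2 = 1 then 1/2 else -1/2) * s a ((i/2) / 2 ^ (k - a))) := by
      refine Finset.prod_congr rfl fun a ha => ?_
      have ha := Finset.mem_range.1 ha
      rw [Nat.div_div_eq_div_mul, Nat.div_div_eq_div_mul, ← pow_succ', ← pow_succ']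
      rw [show k + 1 - a - 1 = k - a - 1 + 1 by omega, show k + 1 - a = k - a + 1 by omega]
    rw [e, ih (i/2) (by rw [pow_succ] at hik; omega)]
    simp only [show k + 1 - k = 1 by omega, Nat.sub_self, pow_zero, Nat.div_one, pow_one]
    by_cases h1 : i / 2 = tpath s k
    · rw [if_pos h1, one_mul]
      simp only [tpath, ← h1]
      rcases hs k (i/2) with h | h
      · rw [h]
        by_cases hi : i % 2 = 1
        · rw [if_pos hi, if_pos (by simp; omega)]; norm_num
        · rw [if_neg hi, if_neg (by simp; omega)]; norm_num
      · rw [h]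
        have : ¬ ((-1:ℝ) = 1) := by norm_num
        by_cases hi : i % 2 = 1
        · rw [if_pos hi, if_neg (by simp only [this, if_false]; omega)]; norm_num
        · rw [if_neg hi, if_pos (by simp only [this, if_false]; omega)]; norm_num
    · rw [if_neg h1, zero_mul, if_neg]
      intro h3
      apply h1
      rw [h3, tpath]; split_ifs <;> omega

open Classical in
lemma tpath_lt (s : ℕ → ℕ → ℝ) (k : ℕ) : tpath s k < 2 ^ k := by
  induction k with
  | zero => simp [tpath]
  | succ k ih => rw [tpath, pow_succ]; split_ifs <;> omega

open Classical in
lemma tpath_div (s : ℕ → ℕ → ℝ) (k m : ℕ) : tpath s (k + m) / 2 ^ m = tpath s k := by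
  induction m with
  | zero => simp
  | succ m ih =>
    rw [pow_succ', ← Nat.div_div_eq_div_mul, ← add_assoc, tpath]
    have : (2 * tpath s (k + m) + if s (k + m) (tpath s (k + m)) = 1 then 1 else 0) / 2 = tpath s (k + m) := by
      split_ifs <;> omega
    rw [this, ih]

noncomputable def hatom (n : ℕ) (s : ℕ → ℕ → ℝ) (k i : ℕ) : ℝ :=
  ∏ a ∈ Finset.range n, (cA k a + cB k i a * s a (i / 2 ^ (k - a)))

open Classical in
lemma hatom_eq (n : ℕ) (s : ℕ → ℕ → ℝ) (hs : ∀ a b, s a b = 1 ∨ s a b = -1) (k i : ℕ) (hk : k < n)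
    (hi : i < 2 ^ k) : hatom n s k i = if i = tpath s k then s k (tpath s k) else 0 := by
  unfold hatom
  rw [← Finset.prod_range_mul_prod_Ico _ (show k + 1 ≤ n by omega), Finset.prod_range_succ]
  have h1 : ∏ a ∈ Finset.Ico (k+1) n, (cA k a + cB k i a * s a (i / 2 ^ (k - a))) = 1 := by
    refine Finset.prod_eq_one fun a ha => ?_
    have := (Finset.mem_Ico.1 ha).1
    simp [cA, cB, show ¬ a < k by omega, show ¬ a = k by omega]
  have h2 : ∏ a ∈ Finset.range k, (cA k a + cB k i a * s a (i / 2 ^ (k - a)))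
      = if i = tpath s k then 1 else 0 := by
    rw [← tree_prod s hs k i hi]
    refine Finset.prod_congr rfl fun a ha => ?_
    have := Finset.mem_range.1 ha
    simp [cA, cB, this]
  rw [h1, h2]
  simp only [cA, cB, lt_irrefl, if_false, if_true, Nat.sub_self, pow_zero, Nat.div_one]
  split_ifs with h
  · rw [h]; ring
  · ring

open Classical in
lemma tree_max (n : ℕ) (s : ℕ → ℕ → ℝ) (hs : ∀ a b, s a b = 1 ∨ s a b = -1) :
    ∃ t ≤ 2 ^ n, (n:ℝ) / 4 ≤ |∑ k ∈ Finset.range n, ∑ i ∈ Finset.range (2 ^ k),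
      if tkey n k i ≤ t then hatom n s k i else 0| := by
  have hsum : ∀ t, ∀ k ∈ Finset.range n, (∑ i ∈ Finset.range (2 ^ k),
      if tkey n k i ≤ t then hatom n s k i else 0)
      = if tkey n k (tpath s k) ≤ t then s k (tpath s k) else 0 := by
    intro t k hk
    rw [Finset.sum_eq_single (tpath s k)]
    · rw [hatom_eq n s hs k _ (Finset.mem_range.1 hk) (tpath_lt s k), if_pos rfl]
    · intro i hi hne
      rw [hatom_eq n s hs k _ (Finset.mem_range.1 hk) (Finset.mem_range.1 hi), if_neg hne]; simp
    · intro h; exact absurd (Finset.mem_range.2 (tpath_lt s k)) h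
  have hk1 : ∀ k ∈ Finset.range n, (if tkey n k (tpath s k) ≤ tpath s n then s k (tpath s k) else 0)
      = if s k (tpath s k) = 1 then 1 else 0 := by
    intro k hk
    have hk := Finset.mem_range.1 hk
    have h := tpath_div s (k + 1) (n - k - 1)
    rw [show k + 1 + (n - k - 1) = n by omega] at h
    have : tkey n k (tpath s k) ≤ tpath s n ↔ s k (tpath s k) = 1 := by
      rw [tkey, ← Nat.le_div_iff_mul_le (by positivity), h, tpath]
      split_ifs with h1 <;> simp [h1]
    by_cases h1 : s k (tpath s k) = 1
    · rw [if_pos (this.2 h1), if_pos h1, h1]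
    · rw [if_neg (fun h2 => h1 (this.1 h2)), if_neg h1]
  have hk2 : ∀ k ∈ Finset.range n, (if tkey n k (tpath s k) ≤ 2 ^ n then s k (tpath s k) else 0)
      = s k (tpath s k) := by
    intro k hk
    have hk := Finset.mem_range.1 hk
    rw [if_pos]
    have h1 := tpath_lt s k
    calc tkey n k (tpath s k) ≤ 2 ^ (k + 1) * 2 ^ (n - k - 1) := by
          unfold tkey; gcongr; rw [pow_succ]; omega
      _ = 2 ^ n := by rw [← pow_add]; congr 1; omega
  have key : 2 * (∑ k ∈ Finset.range n, if s k (tpath s k) = 1 then (1:ℝ) else 0)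
      - ∑ k ∈ Finset.range n, s k (tpath s k) = n := by
    rw [Finset.mul_sum, ← Finset.sum_sub_distrib]
    have : ∀ k ∈ Finset.range n, 2 * (if s k (tpath s k) = 1 then (1:ℝ) else 0) - s k (tpath s k) = 1 := by
      intro k _
      rcases hs k (tpath s k) with h | h
      · rw [if_pos h, h]; norm_num
      · rw [h]; norm_num
    rw [Finset.sum_congr rfl this]; simp
  by_contra hcon
  push Not at hcon
  have c1 := hcon (tpath s n) (tpath_lt s n).le
  have c2 := hcon (2 ^ n) le_rfl
  rw [Finset.sum_congr rfl (hsum _), Finset.sum_congr rfl hk1] at c1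
  rw [Finset.sum_congr rfl (hsum _), Finset.sum_congr rfl hk2] at c2
  have c1 := (abs_lt.1 c1).2
  have c2 := (abs_lt.1 c2).1
  linarith

lemma sort_perm (N : ℕ) (κ : ℕ → ℕ) : ∃ σ : ℕ → ℕ, Set.BijOn σ (Set.Icc 1 N) (Set.Icc 1 N) ∧
    ∀ t, ∃ m ≤ N, (Finset.Icc 1 m).image σ = (Finset.Icc 1 N).filter (fun k => κ k ≤ t) := by
  set f : Fin N → ℕ := fun i => κ (i + 1) with hf
  set τ := Tuple.sort f with hτ
  have hmono := Tuple.monotone_sort f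
  set σ : ℕ → ℕ := fun k => if h : 1 ≤ k ∧ k ≤ N then (τ ⟨k - 1, by omega⟩ : ℕ) + 1 else k with hσ
  have hσk : ∀ k (h : 1 ≤ k ∧ k ≤ N), σ k = (τ ⟨k - 1, by omega⟩ : ℕ) + 1 := fun k h => by
    simp only [hσ]; rw [dif_pos h]
  have hbij : Set.BijOn σ (Set.Icc 1 N) (Set.Icc 1 N) := by
    refine ⟨?_, ?_, ?_⟩
    · intro k hk
      rw [hσk k hk]
      have := (τ ⟨k - 1, by have := hk.1; have := hk.2; omega⟩).2
      exact ⟨by omega, by omega⟩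
    · intro k hk k' hk' h
      rw [hσk k hk, hσk k' hk'] at h
      have h2 := τ.injective (Fin.ext (Nat.succ_injective h))
      have h3 := Fin.mk.inj_iff.1 h2
      have := hk.1; have := hk'.1; omega
    · intro y hy
      obtain ⟨i, hi⟩ := τ.surjective ⟨y - 1, by have := hy.1; have := hy.2; omega⟩
      refine ⟨i + 1, ⟨by omega, by have := i.2; omega⟩, ?_⟩
      rw [hσk (i+1) ⟨by omega, by have := i.2; omega⟩]
      have : (⟨(i:ℕ) + 1 - 1, by have := i.2; omega⟩ : Fin N) = i := Fin.ext (by simp)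
      rw [this, hi]
      have := hy.1
      simp only; omega
  have hm : ∀ k k', 1 ≤ k → k ≤ k' → k' ≤ N → κ (σ k) ≤ κ (σ k') := by
    intro k k' h1 h2 h3
    rw [hσk k ⟨h1, by omega⟩, hσk k' ⟨by omega, h3⟩]
    exact hmono (show (⟨k - 1, _⟩ : Fin N) ≤ ⟨k' - 1, _⟩ from by
      rw [Fin.mk_le_mk]; omega)
  refine ⟨σ, hbij, fun t => ?_⟩
  set S := (Finset.Icc 1 N).filter (fun k => κ (σ k) ≤ t) with hS
  have hSN : S.sup id ≤ N := Finset.sup_le fun k hk => (Finset.mem_Icc.1 (Finset.mem_filter.1 hk).1).2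
  refine ⟨S.sup id, hSN, ?_⟩
  ext y
  rw [Finset.mem_image, Finset.mem_filter, Finset.mem_Icc]
  constructor
  · rintro ⟨k, hk, rfl⟩
    rw [Finset.mem_Icc] at hk
    have hne : S.Nonempty := by
      by_contra h
      rw [Finset.not_nonempty_iff_eq_empty] at h
      rw [h] at hk; simp at hk; omega
    obtain ⟨m, hmS, hme⟩ := Finset.exists_mem_eq_sup S hne id
    rw [hme] at hk
    rw [Finset.mem_filter, Finset.mem_Icc] at hmS
    refine ⟨hbij.mapsTo ⟨hk.1, hk.2.trans hmS.1.2⟩, ?_⟩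
    exact (hm k m hk.1 hk.2 hmS.1.2).trans hmS.2
  · rintro ⟨hy, hyt⟩
    obtain ⟨k, hk, rfl⟩ := hbij.surjOn hy
    refine ⟨k, Finset.mem_Icc.2 ⟨hk.1, ?_⟩, rfl⟩
    exact Finset.le_sup (f := id) (Finset.mem_filter.2 ⟨Finset.mem_Icc.2 hk, hyt⟩)

lemma count_zero {V : Type*} [Fintype V] [DecidableEq V] (R : ℕ) (w : V → ℤ) (hw : w ≠ 0) :
    (Finset.univ.filter (fun M : V → Fin R => ∑ v, w v * (((M v : ℕ) + 1 : ℕ) : ℤ) = 0)).card * R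
      ≤ R ^ Fintype.card V := by
  obtain ⟨v, hv⟩ : ∃ v, w v ≠ 0 := by
    by_contra h; push Not at h; exact hw (funext h)
  set S := Finset.univ.filter (fun M : V → Fin R => ∑ v, w v * (((M v : ℕ) + 1 : ℕ) : ℤ) = 0)
  have h1 : (S ×ˢ (Finset.univ : Finset (Fin R))).card ≤ (Finset.univ : Finset (V → Fin R)).card := by
    refine Finset.card_le_card_of_injOn (fun p => Function.update p.1 v p.2) (fun _ _ => Finset.mem_coe.2 (Finset.mem_univ _)) ?_
    rintro ⟨M, r⟩ hM ⟨M', r'⟩ hM' h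
    simp only at h
    have hM := (Finset.mem_filter.1 (Finset.mem_product.1 hM).1).2
    have hM' := (Finset.mem_filter.1 (Finset.mem_product.1 hM').1).2
    have hr : r = r' := by have := congrFun h v; simpa using this
    have hoff : ∀ u, u ≠ v → M u = M' u := fun u hu => by
      have := congrFun h u; simpa [hu] using this
    have hv2 : M v = M' v := by
      simp only at hM hM'
      rw [← Finset.add_sum_erase _ _ (Finset.mem_univ v)] at hM hM'
      have : ∑ u ∈ Finset.univ.erase v, w u * (((M u : ℕ) + 1 : ℕ) : ℤ)
          = ∑ u ∈ Finset.univ.erase v, w u * (((M' u : ℕ) + 1 : ℕ) : ℤ) :=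
        Finset.sum_congr rfl fun u hu => by rw [hoff u (Finset.ne_of_mem_erase hu)]
      rw [this] at hM
      have h2 : w v * (((M v : ℕ) + 1 : ℕ) : ℤ) = w v * (((M' v : ℕ) + 1 : ℕ) : ℤ) := by linarith
      have h3 := mul_left_cancel₀ hv h2
      apply Fin.ext; omega
    have : M = M' := by
      ext u; by_cases hu : u = v
      · subst hu; rw [hv2]
      · rw [hoff u hu]
    rw [this, hr]
  rw [Finset.card_product] at h1
  simpa using h1

open Classical in
lemma count_inj {V : Type*} [Fintype V] (R : ℕ) (Λ : Finset (V → ℤ)) :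
    (Finset.univ.filter (fun M : V → Fin R =>
      ¬ Set.InjOn (fun w : V → ℤ => ∑ v, w v * (((M v : ℕ) + 1 : ℕ) : ℤ)) Λ)).card * R
      ≤ Λ.card ^ 2 * R ^ Fintype.card V := by
  have hsub : (Finset.univ.filter (fun M : V → Fin R =>
      ¬ Set.InjOn (fun w : V → ℤ => ∑ v, w v * (((M v : ℕ) + 1 : ℕ) : ℤ)) Λ)) ⊆
      ((Λ ×ˢ Λ).filter (fun p => p.1 - p.2 ≠ 0)).biUnion (fun p =>
        Finset.univ.filter (fun M : V → Fin R => ∑ v, (p.1 - p.2) v * (((M v : ℕ) + 1 : ℕ) : ℤ) = 0)) := by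
    intro M hM
    have hM := (Finset.mem_filter.1 hM).2
    unfold Set.InjOn at hM
    push Not at hM
    obtain ⟨w, hw, w', hw', h1, h2⟩ := hM
    rw [Finset.mem_biUnion]
    refine ⟨(w, w'), Finset.mem_filter.2 ⟨Finset.mem_product.2 ⟨hw, hw'⟩, sub_ne_zero.2 h2⟩, ?_⟩
    rw [Finset.mem_filter]
    refine ⟨Finset.mem_univ _, ?_⟩
    simp only [Pi.sub_apply, sub_mul, Finset.sum_sub_distrib]
    rw [h1, sub_self]
  calc _ ≤ (∑ p ∈ (Λ ×ˢ Λ).filter (fun p => p.1 - p.2 ≠ 0), (Finset.univ.filter (fun M : V → Fin R =>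
        ∑ v, (p.1 - p.2) v * (((M v : ℕ) + 1 : ℕ) : ℤ) = 0)).card) * R := by
        gcongr
        exact (Finset.card_le_card hsub).trans Finset.card_biUnion_le
    _ = ∑ p ∈ (Λ ×ˢ Λ).filter (fun p => p.1 - p.2 ≠ 0), (Finset.univ.filter (fun M : V → Fin R =>
        ∑ v, (p.1 - p.2) v * (((M v : ℕ) + 1 : ℕ) : ℤ) = 0)).card * R := by rw [Finset.sum_mul]
    _ ≤ ∑ p ∈ (Λ ×ˢ Λ).filter (fun p => p.1 - p.2 ≠ 0), R ^ Fintype.card V := by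
        refine Finset.sum_le_sum fun p hp => ?_
        convert count_zero R (p.1 - p.2) (Finset.mem_filter.1 hp).2
    _ ≤ Λ.card ^ 2 * R ^ Fintype.card V := by
        rw [Finset.sum_const, smul_eq_mul]
        gcongr
        refine (Finset.card_filter_le _ _).trans ?_
        rw [Finset.card_product, sq]

lemma avg_pick {ι : Type*} [Fintype ι] [DecidableEq ι] (G : Set ℝ) (hG : MeasurableSet G) (hG1 : volume G ≤ 1)
    (E : ι → ℝ → ℝ) (hE : ∀ M, Measurable (E M)) (hE0 : ∀ M x, 0 ≤ E M x)
    (hs : ∀ x ∈ G, ∑ M, E M x ≤ Fintype.card ι / 8) (bad : Finset ι) (hbad : 4 * bad.card ≤ Fintype.card ι)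
    (hι : 0 < Fintype.card ι) :
    ∃ M ∉ bad, ∫⁻ x in G, ENNReal.ofReal (E M x) ≤ ENNReal.ofReal (1/4) := by
  by_contra! hcon
  have h1 : ∑ M, ∫⁻ x in G, ENNReal.ofReal (E M x) ≤ ENNReal.ofReal (Fintype.card ι / 8) := by
    rw [← lintegral_finsetSum _ (fun M _ => (hE M).ennreal_ofReal)]
    calc ∫⁻ x in G, ∑ M, ENNReal.ofReal (E M x) ≤ ∫⁻ x in G, ENNReal.ofReal (Fintype.card ι / 8) := by
          refine setLIntegral_mono measurable_const fun x hx => ?_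
          rw [← ENNReal.ofReal_sum_of_nonneg (fun M _ => hE0 M x)]
          exact ENNReal.ofReal_le_ofReal (hs x hx)
      _ = ENNReal.ofReal (Fintype.card ι / 8) * volume G := by simp
      _ ≤ _ := mul_le_of_le_one_right' hG1
  have h2 : ∑ M ∈ badᶜ, ENNReal.ofReal (1/4) ≤ ∑ M, ∫⁻ x in G, ENNReal.ofReal (E M x) := by
    refine (Finset.sum_le_sum fun M hM => (hcon M (Finset.mem_compl.1 hM)).le).trans ?_
    exact Finset.sum_le_sum_of_subset (Finset.subset_univ _)
  have h3 := h2.trans h1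
  rw [← ENNReal.ofReal_sum_of_nonneg (fun M _ => by norm_num), ENNReal.ofReal_le_ofReal_iff (by positivity),
    Finset.sum_const, Finset.card_compl, nsmul_eq_mul, Nat.cast_sub (Finset.card_le_univ _)] at h3
  have h4 : (4:ℝ) * bad.card ≤ Fintype.card ι := by exact_mod_cast hbad
  have h5 : (0:ℝ) < Fintype.card ι := by exact_mod_cast hι
  linarith

def atoms (n : ℕ) : Finset (Σ _ : ℕ, ℕ) := (Finset.range n).sigma (fun k => Finset.range (2 ^ k))

lemma mem_atoms (n : ℕ) (p : Σ _ : ℕ, ℕ) : p ∈ atoms n ↔ p.1 < n ∧ p.2 < 2 ^ p.1 := by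
  simp [atoms]

lemma atoms_card (n : ℕ) : (atoms n).card ≤ 2 ^ n := by
  rw [atoms, Finset.card_sigma]
  simp only [Finset.card_range]
  have := Nat.geomSum_eq (le_refl 2) n
  rw [this]; simp

def qq (n k i : ℕ) (a : Fin n) : Fin n × Fin (2 ^ n) :=
  (a, ⟨(i / 2 ^ (k - a)) % 2 ^ n, Nat.mod_lt _ (by positivity)⟩)

lemma qq_inj (n k i : ℕ) : Function.Injective (qq n k i) := fun a b h => (Prod.ext_iff.1 h).1

noncomputable def cf (n : ℕ) (l : (Σ _ : ℕ, ℕ) × (Fin n → ℤ)) : ℂ :=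
  ∏ a : Fin n, coef (cA l.1.1 a) (cB l.1.1 l.1.2 a) (l.2 a)

open Classical in
noncomputable def Lam (n T : ℕ) : Finset ((Σ _ : ℕ, ℕ) × (Fin n → ℤ)) :=
  (atoms n ×ˢ cross n T).filter (fun l => cf n l ≠ 0)

lemma Lam_card (n T : ℕ) : (Lam n T).card ≤ 2 ^ n * (2 ^ (16 * T) * 4 ^ n) := by
  refine (Finset.card_filter_le _ _).trans ?_
  rw [Finset.card_product]
  exact Nat.mul_le_mul (atoms_card n) (cross_card n T)

lemma Lam_prop (n T : ℕ) (l) (hl : l ∈ Lam n T) : ∃ h : l.1.1 < n, l.1.2 < 2 ^ l.1.1 ∧ l.2 ⟨l.1.1, h⟩ ≠ 0 ∧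
    ∀ a : Fin n, l.1.1 < a → l.2 a = 0 := by
  obtain ⟨h1, h2⟩ := Finset.mem_filter.1 hl
  obtain ⟨h3, h4⟩ := (mem_atoms _ _).1 (Finset.mem_product.1 h1).1
  rw [cf, Finset.prod_ne_zero_iff] at h2
  refine ⟨h3, h4, ?_, ?_⟩
  · intro h
    apply h2 ⟨l.1.1, h3⟩ (Finset.mem_univ _)
    rw [h]; simp [coef, cA]
  · intro a ha
    by_contra h
    apply h2 a (Finset.mem_univ _)
    simp [coef, h, cB, show ¬ (a:ℕ) < l.1.1 by omega, show ¬ (a:ℕ) = l.1.1 by omega]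

def ww (n : ℕ) (l : (Σ _ : ℕ, ℕ) × (Fin n → ℤ)) (v : Fin n × Fin (2 ^ n)) : ℤ :=
  if qq n l.1.1 l.1.2 v.1 = v then l.2 v.1 else 0

lemma ww_qq (n : ℕ) (l : (Σ _ : ℕ, ℕ) × (Fin n → ℤ)) (a : Fin n) :
    ww n l (qq n l.1.1 l.1.2 a) = l.2 a := if_pos rfl

lemma ww_sum (n : ℕ) (l : (Σ _ : ℕ, ℕ) × (Fin n → ℤ)) (g : Fin n × Fin (2 ^ n) → ℤ) :
    ∑ v, ww n l v * g v = ∑ a, l.2 a * g (qq n l.1.1 l.1.2 a) := by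
  rw [Fintype.sum_prod_type]
  refine Finset.sum_congr rfl fun a _ => ?_
  rw [Finset.sum_eq_single (qq n l.1.1 l.1.2 a).2]
  · exact congrArg (· * g (qq n l.1.1 l.1.2 a)) (ww_qq n l a)
  · intro b _ hb
    rw [ww, if_neg, zero_mul]
    intro h; exact hb (by rw [h])
  · simp

lemma ww_aux (n T : ℕ) (l l') (hl : l ∈ Lam n T) (hl' : l' ∈ Lam n T) (h : ww n l = ww n l') :
    l.1.1 ≤ l'.1.1 ∧ l'.1.2 / 2 ^ (l'.1.1 - l.1.1) = l.1.2 := by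
  obtain ⟨h1, h2, h3, h4⟩ := Lam_prop n T l hl
  obtain ⟨h1', h2', h3', h4'⟩ := Lam_prop n T l' hl'
  have hlt : l.1.2 < 2 ^ n := h2.trans (Nat.pow_lt_pow_right (by norm_num) h1)
  have hlt' : l'.1.2 < 2 ^ n := h2'.trans (Nat.pow_lt_pow_right (by norm_num) h1')
  have e1 : ww n l (⟨l.1.1, h1⟩, ⟨l.1.2, hlt⟩) = l.2 ⟨l.1.1, h1⟩ := by
    rw [ww, if_pos]
    simp [qq, Nat.mod_eq_of_lt hlt]
  rw [h, ww] at e1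
  split_ifs at e1 with h5
  · constructor
    · by_contra h6
      exact h3 (e1.symm.trans (h4' _ (by simpa using h6)))
    · simp only [qq, Prod.mk.injEq, Fin.mk.injEq, true_and] at h5
      rwa [Nat.mod_eq_of_lt ((Nat.div_le_self _ _).trans_lt hlt')] at h5
  · exact absurd e1.symm h3

lemma ww_inj (n T : ℕ) : Set.InjOn (ww n) (Lam n T : Set ((Σ _ : ℕ, ℕ) × (Fin n → ℤ))) := by
  intro l hl l' hl' h
  obtain ⟨h1, h2⟩ := ww_aux n T l l' hl hl' h
  obtain ⟨h1', h2'⟩ := ww_aux n T l' l hl' hl h.symm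
  have hk : l.1.1 = l'.1.1 := le_antisymm h1 h1'
  have hi : l.1.2 = l'.1.2 := by rw [hk] at h2; simpa using h2.symm
  have hp : l.1 = l'.1 := by
    rcases l with ⟨⟨k, i⟩, j⟩
    rcases l' with ⟨⟨k', i'⟩, j'⟩
    simp only at hk hi
    subst hk; subst hi; rfl
  refine Prod.ext hp ?_
  funext a
  have := congrFun h (qq n l.1.1 l.1.2 a)
  rw [ww_qq, hp, ww_qq] at this
  exact this

def ph (n R : ℕ) (M : Fin n × Fin (2 ^ n) → Fin R) (k i : ℕ) (a : Fin n) : ℕ := (M (qq n k i a) : ℕ) + 1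

noncomputable def er (n T R : ℕ) (M : Fin n × Fin (2 ^ n) → Fin R) (p : Σ _ : ℕ, ℕ) (x : ℝ) : ℝ :=
  ‖((∏ a : Fin n, (cA p.1 a + cB p.1 p.2 a * sqw ((ph n R M p.1 p.2 a : ℕ) * x)) : ℝ) : ℂ)
    - Ht T (fun a : Fin n => cA p.1 a) (fun a : Fin n => cB p.1 p.2 a) (fun a => (ph n R M p.1 p.2 a : ℕ) * x)‖

lemma er_meas (n T R : ℕ) (M : Fin n × Fin (2 ^ n) → Fin R) (p : Σ _ : ℕ, ℕ) : Measurable (er n T R M p) := by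
  unfold er
  refine Measurable.norm (Measurable.sub ?_ ?_)
  · refine Complex.measurable_ofReal.comp ?_
    refine Finset.measurable_fun_prod _ fun a _ => ?_
    exact ((sqw_measurable.comp (measurable_const.mul measurable_id)).const_mul _).const_add _
  · unfold Ht
    refine Continuous.measurable ?_
    refine continuous_finsetSum _ fun j _ => continuous_finsetProd _ fun a _ => ?_
    exact ((continuous_trigChar _).comp (continuous_const.mul continuous_id)).const_mul _

lemma cA_le (k a : ℕ) : |cA k a| ≤ 1 := by
  unfold cA; split_ifs <;> norm_num [abs_le]

lemma cB_le (k i a : ℕ) : |cB k i a| ≤ 1 := by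
  unfold cB; split_ifs <;> norm_num [abs_le]

lemma choose_M (n : ℕ) (hn : 1 ≤ n) : ∃ M : Fin n × Fin (2 ^ n) → Fin (2 ^ (650 * n)),
    Set.InjOn (fun l : (Σ _ : ℕ, ℕ) × (Fin n → ℤ) => ∑ a, l.2 a * (ph n _ M l.1.1 l.1.2 a : ℤ)) (Lam n (20 * n)) ∧
    ∃ S : Set ℝ, S ⊆ Set.Ioc 0 1 ∧ ENNReal.ofReal (1/2) ≤ volume S ∧
      ∀ x ∈ S, ∑ p ∈ atoms n, er n (20 * n) _ M p x ≤ 1 := by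
  classical
  obtain ⟨R, hR⟩ : ∃ R, R = 2 ^ (650 * n) := ⟨_, rfl⟩
  rw [← hR]
  have hR1 : 1 ≤ R := by rw [hR]; exact Nat.one_le_two_pow
  obtain ⟨G, hGm, hGs, hGv, hG⟩ := good_set (20 * n) R hR1
  have hGv' : ENNReal.ofReal (3/4) ≤ volume G := by
    rw [Measure.real, Measure.restrict_apply hGm, Set.inter_eq_left.2 hGs] at hGv
    exact ENNReal.ofReal_le_of_le_toReal hGv
  have hG1 : volume G ≤ 1 := (measure_mono hGs).trans (by simp)
  set bad := Finset.univ.filter (fun M : Fin n × Fin (2 ^ n) → Fin R =>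
      ¬ Set.InjOn (fun w : Fin n × Fin (2 ^ n) → ℤ => ∑ v, w v * (((M v : ℕ) + 1 : ℕ) : ℤ)) ((Lam n (20 * n)).image (ww n))) with hbad
  have hcard : Fintype.card (Fin n × Fin (2 ^ n) → Fin R) = R ^ Fintype.card (Fin n × Fin (2 ^ n)) := by simp
  have hb : 4 * bad.card ≤ Fintype.card (Fin n × Fin (2 ^ n) → Fin R) := by
    have h1 := count_inj R ((Lam n (20 * n)).image (ww n))
    have h2 : ((Lam n (20 * n)).image (ww n)).card ≤ 2 ^ (323 * n) := by
      refine Finset.card_image_le.trans ((Lam_card n _).trans (le_of_eq ?_))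
      rw [show (4:ℕ) = 2 ^ 2 by norm_num, ← pow_mul, ← pow_add, ← pow_add]; congr 1; ring
    rw [hcard]
    have h3 : bad.card * R ≤ (2 ^ (323 * n)) ^ 2 * R ^ Fintype.card (Fin n × Fin (2 ^ n)) := by
      refine le_trans ?_ (h1.trans (by gcongr))
      apply le_of_eq
      congr!
    have h4 : R = (2 ^ (323 * n)) ^ 2 * 2 ^ (4 * n) := by
      rw [hR, ← pow_mul, ← pow_add]; congr 1; ring
    have h5 : bad.card * 2 ^ (4 * n) ≤ R ^ Fintype.card (Fin n × Fin (2 ^ n)) := by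
      rw [show bad.card * R = (2 ^ (323 * n)) ^ 2 * (bad.card * 2 ^ (4 * n)) from
        (congrArg (bad.card * ·) h4).trans (by ring)] at h3
      exact Nat.le_of_mul_le_mul_left h3 (by positivity)
    have h6 : 4 ≤ 2 ^ (4 * n) := by
      calc 4 = 2 ^ 2 := by norm_num
        _ ≤ 2 ^ (4 * n) := Nat.pow_le_pow_right (by norm_num) (by omega)
    calc 4 * bad.card ≤ bad.card * 2 ^ (4 * n) := by rw [mul_comm]; gcongr
      _ ≤ _ := h5
  obtain ⟨M, hM1, hM2⟩ := avg_pick G hGm hG1 (fun (M : Fin n × Fin (2 ^ n) → Fin R) x => ∑ p ∈ atoms n, er n (20 * n) R M p x)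
    (fun M => Finset.measurable_fun_sum _ fun p _ => er_meas _ _ _ _ _)
    (fun M x => Finset.sum_nonneg fun p _ => norm_nonneg _) (by
      intro x hx
      rw [Finset.sum_comm]
      calc ∑ p ∈ atoms n, ∑ M, er n (20 * n) R M p x
          ≤ ∑ p ∈ atoms n, (R:ℝ) ^ (Fintype.card (Fin n × Fin (2 ^ n))) * (128 ^ n / 2 ^ (20 * n)) := by
            refine Finset.sum_le_sum fun p _ => ?_
            exact err_avg (20 * n) R (qq n p.1 p.2) (qq_inj _ _ _) _ _ (fun a => cA_le _ _) (fun a => cB_le _ _ _) x (hG x hx)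
        _ ≤ 2 ^ n * ((R:ℝ) ^ (Fintype.card (Fin n × Fin (2 ^ n))) * (128 ^ n / 2 ^ (20 * n))) := by
            rw [Finset.sum_const, nsmul_eq_mul]
            gcongr
            exact_mod_cast atoms_card n
        _ = (R:ℝ) ^ (Fintype.card (Fin n × Fin (2 ^ n))) * (1 / 2 ^ (12 * n)) := by
            rw [show (128:ℝ) = 2 ^ 7 by norm_num, ← pow_mul, show 20 * n = 7 * n + n + 12 * n by ring, pow_add, pow_add]
            field_simp
        _ ≤ (R:ℝ) ^ (Fintype.card (Fin n × Fin (2 ^ n))) * (1 / 8) := by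
            have : (8:ℝ) ≤ 2 ^ (12 * n) := by
              calc (8:ℝ) = 2 ^ 3 := by norm_num
                _ ≤ 2 ^ (12 * n) := pow_le_pow_right₀ (by norm_num) (by omega)
            gcongr
        _ = _ := by rw [hcard]; push_cast; ring) bad hb (by rw [hcard]; positivity)
  refine ⟨M, ?_, {x ∈ G | ∑ p ∈ atoms n, er n (20 * n) R M p x < 1}, fun x hx => hGs hx.1, ?_, fun x hx => hx.2.le⟩
  · have hM : Set.InjOn (fun w : Fin n × Fin (2 ^ n) → ℤ => ∑ v, w v * (((M v : ℕ) + 1 : ℕ) : ℤ)) ((Lam n (20 * n)).image (ww n)) := by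
      by_contra h
      exact hM1 (Finset.mem_filter.2 ⟨Finset.mem_univ _, h⟩)
    intro l hl l' hl' h
    refine ww_inj n (20 * n) hl hl' (hM ?_ ?_ ?_)
    · exact Finset.mem_coe.2 (Finset.mem_image_of_mem _ hl)
    · exact Finset.mem_coe.2 (Finset.mem_image_of_mem _ hl')
    · simp only [ww_sum]
      exact h
  · set E : ℝ → ℝ := fun x => ∑ p ∈ atoms n, er n (20 * n) R M p x with hE
    have hEm : Measurable E := Finset.measurable_fun_sum _ fun p _ => er_meas _ _ _ _ _
    have h1 := mul_meas_ge_le_lintegral (μ := volume.restrict G) hEm.ennreal_ofReal 1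
    rw [one_mul] at h1
    have h2 : volume (G ∩ {x | 1 ≤ E x}) ≤ ENNReal.ofReal (1/4) := by
      refine le_trans ?_ (h1.trans hM2)
      rw [Measure.restrict_apply (measurableSet_le measurable_const hEm.ennreal_ofReal), Set.inter_comm]
      refine measure_mono fun x hx => ⟨?_, hx.2⟩
      have := hx.1
      simp only [Set.mem_ofPred_eq] at this ⊢
      rwa [ENNReal.one_le_ofReal]
    have h3 : volume G ≤ volume {x ∈ G | E x < 1} + volume (G ∩ {x | 1 ≤ E x}) := by
      refine le_trans (measure_mono ?_) (measure_union_le _ _)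
      intro x hx
      rcases lt_or_ge (E x) 1 with h | h
      · exact Or.inl ⟨hx, h⟩
      · exact Or.inr ⟨hx, h⟩
    have h4 : ENNReal.ofReal (1/2) + ENNReal.ofReal (1/4) ≤ volume {x ∈ G | E x < 1} + ENNReal.ofReal (1/4) := by
      rw [← ENNReal.ofReal_add (by norm_num) (by norm_num)]
      refine le_trans (le_of_eq (by norm_num)) (hGv'.trans (h3.trans (by gcongr)))
    exact (ENNReal.add_le_add_iff_right ENNReal.ofReal_ne_top).1 h4

lemma build {ι : Type*} [Nonempty ι] (Λ : Finset ι) (f : ι → ℕ) (c : ι → ℂ) (key : ι → ℕ) (B N : ℕ)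
    (hinj : Set.InjOn f Λ) (hf : ∀ l ∈ Λ, 1 ≤ f l ∧ f l < N) (hN : 1 ≤ N) :
    ∃ (a : ℕ → ℂ) (σ : ℕ → ℕ), Set.BijOn σ (Set.Icc 1 N) (Set.Icc 1 N) ∧
      ∑ k ∈ Finset.Icc 1 N, ‖a k‖ ^ 2 = ∑ l ∈ Λ, ‖c l‖ ^ 2 + 1 ∧
      ∀ t ≤ B, ∃ m ≤ N, ∀ x, ∑ k ∈ Finset.Icc 1 m, a (σ k) * trigChar (σ k : ℤ) x
        = ∑ l ∈ Λ with key l ≤ t, c l * trigChar (f l : ℤ) x := by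
  classical
  set g : ℕ → ι := Function.invFunOn f Λ with hg
  have hgf : ∀ l ∈ Λ, g (f l) = l := fun l hl => hinj.leftInvOn_invFunOn hl
  set a : ℕ → ℂ := fun k => if k ∈ Λ.image f then c (g k) else if k = N then 1 else 0 with ha
  set κ : ℕ → ℕ := fun k => if k ∈ Λ.image f then key (g k) else B + 1 with hκ
  have haf : ∀ l ∈ Λ, a (f l) = c l := fun l hl => by
    simp only [ha]; rw [if_pos (Finset.mem_image_of_mem _ hl), hgf l hl]
  have hκf : ∀ l ∈ Λ, κ (f l) = key l := fun l hl => by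
    simp only [hκ]; rw [if_pos (Finset.mem_image_of_mem _ hl), hgf l hl]
  have hNi : N ∉ Λ.image f := by
    intro h
    obtain ⟨l, hl, h⟩ := Finset.mem_image.1 h
    exact absurd h (hf l hl).2.ne
  obtain ⟨σ, hσ, hσ2⟩ := sort_perm N κ
  refine ⟨a, σ, hσ, ?_, ?_⟩
  · rw [← Finset.sum_subset (s₁ := insert N (Λ.image f))]
    · rw [Finset.sum_insert hNi, Finset.sum_image hinj, add_comm]
      congr 1
      · exact Finset.sum_congr rfl fun l hl => by rw [haf l hl]
      · simp only [ha]; rw [if_neg hNi]; simp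
    · intro k hk
      rw [Finset.mem_insert] at hk
      rw [Finset.mem_Icc]
      rcases hk with h | h
      · omega
      · obtain ⟨l, hl, h⟩ := Finset.mem_image.1 h
        have := hf l hl
        omega
    · intro k _ hk
      rw [Finset.mem_insert, not_or] at hk
      simp only [ha]; rw [if_neg hk.2, if_neg hk.1]; simp
  · intro t ht
    obtain ⟨m, hm, hm2⟩ := hσ2 t
    refine ⟨m, hm, fun x => ?_⟩
    have hσm : Set.InjOn σ (Finset.Icc 1 m : Finset ℕ) := by
      refine hσ.injOn.mono ?_
      intro k hk
      have := Finset.mem_Icc.1 (Finset.mem_coe.1 hk)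
      exact ⟨this.1, this.2.trans hm⟩
    rw [← Finset.sum_image (f := fun k => a k * trigChar (k : ℤ) x) hσm, hm2]
    have hset : (Finset.Icc 1 N).filter (fun k => κ k ≤ t) = (Λ.filter (fun l => key l ≤ t)).image f := by
      ext k
      simp only [Finset.mem_filter, Finset.mem_Icc, Finset.mem_image]
      constructor
      · rintro ⟨hk1, hk2⟩
        by_cases hk : k ∈ Λ.image f
        · obtain ⟨l, hl, rfl⟩ := Finset.mem_image.1 hk
          rw [hκf l hl] at hk2
          exact ⟨l, ⟨hl, hk2⟩, rfl⟩
        · simp only [hκ] at hk2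
          rw [if_neg hk] at hk2
          omega
      · rintro ⟨l, ⟨hl, hlt⟩, rfl⟩
        have := hf l hl
        rw [hκf l hl]
        exact ⟨⟨this.1, this.2.le⟩, hlt⟩
    rw [hset, Finset.sum_image (hinj.mono (by
      intro l hl; exact Finset.mem_coe.2 (Finset.mem_filter.1 (Finset.mem_coe.1 hl)).1))]
    exact Finset.sum_congr rfl fun l hl => by rw [haf l (Finset.mem_filter.1 hl).1]

lemma l2_poly (N : ℕ) (a : ℕ → ℂ) : l2normT (fun x => ∑ k ∈ Finset.Icc 1 N, a k * trigChar (k : ℤ) x)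
    = (∑ k ∈ Finset.Icc 1 N, ‖a k‖ ^ 2) ^ ((1:ℝ)/2) := by
  unfold l2normT
  congr 1
  have h := poly_norm ((Finset.Icc 1 N).map Nat.castEmbedding) (fun j => a j.toNat)
  simpa only [Finset.sum_map, Nat.castEmbedding_apply, Int.toNat_natCast] using h

lemma trigChar_sum {ι : Type*} (s : Finset ι) (j : ι → ℤ) (x : ℝ) :
    ∏ a ∈ s, trigChar (j a) x = trigChar (∑ a ∈ s, j a) x := by
  classical
  induction s using Finset.induction_on with
  | empty => simp [trigChar_zero]
  | insert a s ha ih => rw [Finset.prod_insert ha, Finset.sum_insert ha, trigChar_add, ih]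

lemma prod_AB (n k i : ℕ) (hk : k < n) :
    ∏ a : Fin n, (cA k a ^ 2 + cB k i a ^ 2) = (1/2) ^ k := by
  rw [← Finset.prod_range (fun a => cA k a ^ 2 + cB k i a ^ 2),
    ← Finset.prod_range_mul_prod_Ico _ hk.le]
  have h1 : ∏ a ∈ Finset.range k, (cA k a ^ 2 + cB k i a ^ 2) = (1/2) ^ k := by
    rw [Finset.prod_congr rfl (g := fun _ => (1/2:ℝ)), Finset.prod_const, Finset.card_range]
    intro a ha
    have := Finset.mem_range.1 ha
    simp only [cA, cB, this, if_true]
    split_ifs <;> norm_num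
  have h2 : ∏ a ∈ Finset.Ico k n, (cA k a ^ 2 + cB k i a ^ 2) = 1 := by
    refine Finset.prod_eq_one fun a ha => ?_
    have := (Finset.mem_Ico.1 ha).1
    simp only [cA, cB, show ¬ a < k by omega, if_false]
    split_ifs <;> norm_num
  rw [h1, h2, mul_one]

lemma cf_l2 (n T : ℕ) : ∑ l ∈ Lam n T, ‖cf n l‖ ^ 2 ≤ n := by
  calc ∑ l ∈ Lam n T, ‖cf n l‖ ^ 2 ≤ ∑ l ∈ atoms n ×ˢ cross n T, ‖cf n l‖ ^ 2 :=
        Finset.sum_le_sum_of_subset_of_nonneg (Finset.filter_subset _ _) fun _ _ _ => by positivity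
    _ = ∑ p ∈ atoms n, ∑ j ∈ cross n T, ∏ a : Fin n, ‖coef (cA p.1 a) (cB p.1 p.2 a) (j a)‖ ^ 2 := by
        rw [Finset.sum_product]
        simp only [cf, norm_prod, Finset.prod_pow]
    _ ≤ ∑ p ∈ atoms n, (1/2:ℝ) ^ p.1 := by
        refine Finset.sum_le_sum fun p hp => ?_
        rw [← prod_AB n p.1 p.2 ((mem_atoms _ _).1 hp).1]
        exact coef_l2 T (fun a : Fin n => cA p.1 a) (fun a : Fin n => cB p.1 p.2 a)
    _ = n := by
        rw [atoms, Finset.sum_sigma]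
        simp only [Finset.sum_const, Finset.card_range, nsmul_eq_mul]
        have : ∀ k : ℕ, ((2 ^ k : ℕ) : ℝ) * (1/2) ^ k = 1 := fun k => by
          push_cast; rw [← mul_pow]; norm_num
        simp [this]

noncomputable def fr (n R : ℕ) (M : Fin n × Fin (2 ^ n) → Fin R) (l : (Σ _ : ℕ, ℕ) × (Fin n → ℤ)) : ℤ :=
  ∑ a, l.2 a * (ph n R M l.1.1 l.1.2 a : ℤ)

lemma Ht_cf (n T R : ℕ) (M : Fin n × Fin (2 ^ n) → Fin R) (p : Σ _ : ℕ, ℕ) (x : ℝ) :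
    Ht T (fun a : Fin n => cA p.1 a) (fun a : Fin n => cB p.1 p.2 a) (fun a => (ph n R M p.1 p.2 a : ℕ) * x)
     = ∑ j ∈ cross n T, cf n (p, j) * trigChar (fr n R M (p, j)) x := by
  unfold Ht
  refine Finset.sum_congr rfl fun j _ => ?_
  rw [Finset.prod_mul_distrib, fr, ← trigChar_sum]
  congr 1
  refine Finset.prod_congr rfl fun a _ => ?_
  rw [← trigChar_mul]; simp

lemma Lam_sum (n T R : ℕ) (M : Fin n × Fin (2 ^ n) → Fin R) (t : ℕ) (x : ℝ) :
    ∑ l ∈ Lam n T with tkey n l.1.1 l.1.2 ≤ t, cf n l * trigChar (fr n R M l) x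
     = ∑ p ∈ atoms n with tkey n p.1 p.2 ≤ t,
      Ht T (fun a : Fin n => cA p.1 a) (fun a : Fin n => cB p.1 p.2 a) (fun a => (ph n R M p.1 p.2 a : ℕ) * x) := by
  simp_rw [Ht_cf]
  rw [← Finset.sum_product (f := fun l => cf n l * trigChar (fr n R M l) x)]
  refine Finset.sum_subset ?_ ?_
  · intro l hl
    simp only [Lam, Finset.mem_filter, Finset.mem_product] at hl ⊢
    tauto
  · intro l hl hl2
    simp only [Lam, Finset.mem_filter, Finset.mem_product] at hl hl2
    have : cf n l = 0 := by tauto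
    rw [this, zero_mul]

lemma low_bd (n T R : ℕ) (M : Fin n × Fin (2 ^ n) → Fin R) (x : ℝ)
    (hx : ∑ p ∈ atoms n, er n T R M p x ≤ 1) :
    ∃ t ≤ 2 ^ n, (n:ℝ) / 4 - 1 ≤
      ‖∑ l ∈ Lam n T with tkey n l.1.1 l.1.2 ≤ t, cf n l * trigChar (fr n R M l) x‖ := by
  set s : ℕ → ℕ → ℝ := fun a r => if h : a < n then
    sqw ((((M (⟨a, h⟩, ⟨r % 2 ^ n, Nat.mod_lt _ (by positivity)⟩) : ℕ) + 1 : ℕ) : ℝ) * x) else 1 with hs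
  obtain ⟨t, ht, h⟩ := tree_max n s (by
    intro a b
    simp only [hs]
    split_ifs
    · exact sqw_cases _
    · left; rfl)
  refine ⟨t, ht, ?_⟩
  set H : (Σ _ : ℕ, ℕ) → ℝ := fun p => ∏ a : Fin n, (cA p.1 a + cB p.1 p.2 a * sqw ((ph n R M p.1 p.2 a : ℕ) * x)) with hH
  have hh : ∀ p, hatom n s p.1 p.2 = H p := by
    intro p
    rw [hatom, Finset.prod_range]
    refine Finset.prod_congr rfl fun a _ => ?_
    simp only [hs, a.2, dif_pos]
    rfl
  rw [← Finset.sum_sigma (f := fun p : (Σ _ : ℕ, ℕ) => if tkey n p.1 p.2 ≤ t then hatom n s p.1 p.2 else 0)] at h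
  change (n:ℝ) / 4 ≤ |∑ p ∈ atoms n, _| at h
  rw [← Finset.sum_filter] at h
  simp_rw [hh] at h
  rw [Lam_sum]
  set K : (Σ _ : ℕ, ℕ) → ℂ := fun p => Ht T (fun a : Fin n => cA p.1 a) (fun a : Fin n => cB p.1 p.2 a) (fun a => (ph n R M p.1 p.2 a : ℕ) * x) with hK
  have h1 : ‖∑ p ∈ atoms n with tkey n p.1 p.2 ≤ t, ((H p : ℝ) : ℂ)‖ - ‖∑ p ∈ atoms n with tkey n p.1 p.2 ≤ t, K p‖ ≤ 1 := by
    refine (norm_sub_norm_le _ _).trans ?_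
    rw [← Finset.sum_sub_distrib]
    refine (norm_sum_le _ _).trans (le_trans ?_ hx)
    exact Finset.sum_le_sum_of_subset_of_nonneg (Finset.filter_subset _ _) fun _ _ _ => norm_nonneg _
  rw [← Complex.ofReal_sum, Complex.norm_real, Real.norm_eq_abs] at h1
  linarith

lemma fr_bd (n : ℕ) (M : Fin n × Fin (2 ^ n) → Fin (2 ^ (650 * n))) (l) (hl : l ∈ Lam n (20 * n)) :
    |fr n _ M l| < 2 ^ (811 * n) := by
  have h1 := (Finset.mem_product.1 (Finset.mem_filter.1 hl).1).2
  rw [mem_cross] at h1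
  have h2 : ∀ a, |l.2 a| ≤ 2 ^ (160 * n) := by
    intro a
    have h3 : lev (l.2 a) ≤ 20 * n :=
      (Finset.single_le_sum (f := fun a => lev (l.2 a)) (fun _ _ => Nat.zero_le _) (Finset.mem_univ a)).trans h1
    rw [lev_le_iff] at h3
    rw [Int.abs_eq_natAbs]
    have h4 : (256:ℕ) ^ (20 * n) = 2 ^ (160 * n) := by
      rw [show (256:ℕ) = 2 ^ 8 by norm_num, ← pow_mul]; congr 1; ring
    rw [h4] at h3
    exact_mod_cast h3.le
  calc |fr n _ M l| ≤ ∑ a : Fin n, |l.2 a * (ph n _ M l.1.1 l.1.2 a : ℤ)| := Finset.abs_sum_le_sum_abs _ _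
    _ ≤ ∑ a : Fin n, (2:ℤ) ^ (160 * n) * 2 ^ (650 * n) := by
        refine Finset.sum_le_sum fun a _ => ?_
        rw [abs_mul]
        have h5 : ph n _ M l.1.1 l.1.2 a ≤ 2 ^ (650 * n) := (M (qq n l.1.1 l.1.2 a)).2
        have h6 : |(ph n _ M l.1.1 l.1.2 a : ℤ)| ≤ 2 ^ (650 * n) := by
          rw [abs_of_nonneg (by positivity)]; exact_mod_cast h5
        exact mul_le_mul (h2 a) h6 (abs_nonneg _) (by positivity)
    _ = n * 2 ^ (810 * n) := by
        rw [Finset.sum_const, Finset.card_univ, Fintype.card_fin, nsmul_eq_mul, ← pow_add]; congr 2; ring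
    _ < 2 ^ n * 2 ^ (810 * n) := by
        have : (n:ℤ) < 2 ^ n := by exact_mod_cast Nat.lt_two_pow_self
        gcongr
    _ = _ := by rw [← pow_add]; congr 1; ring

lemma main_n (n N : ℕ) (hn : 8 ≤ n) (hN : 2 ^ (900 * n) ≤ N) (hN2 : N < 2 ^ (900 * (n + 1))) :
      ∃ (a : ℕ → ℂ) (σ : ℕ → ℕ), Set.BijOn σ (Set.Icc 1 N) (Set.Icc 1 N) ∧
        1 ≤ ∑ k ∈ Finset.Icc 1 N, ‖a k‖ ^ 2 ∧ ∑ k ∈ Finset.Icc 1 N, ‖a k‖ ^ 2 ≤ 400 ^ 2 + 1 ∧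
        ENNReal.ofReal (1/2) ≤
          volume {x ∈ Set.Ioc (0:ℝ) 1 | Real.sqrt (Real.log N) <
            ⨆ m : Finset.Icc 1 N,
              ‖∑ k ∈ Finset.Icc 1 (m : ℕ), a (σ k) * trigChar (σ k : ℤ) x‖} := by
  obtain ⟨M, hMi, S, hS1, hS2, hS3⟩ := choose_M n (by omega)
  have hn0 : (0:ℝ) < n := by have : 0 < n := by omega
                             exact_mod_cast this
  have hn8 : (8:ℝ) ≤ n := by exact_mod_cast hn
  have hsn : 0 < Real.sqrt n := Real.sqrt_pos.2 hn0
  set b : ℝ := 400 / Real.sqrt n with hb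
  have hb0 : 0 < b := by positivity
  have hbn : b * n = 400 * Real.sqrt n := by
    rw [hb, div_mul_eq_mul_div, div_eq_iff hsn.ne', mul_assoc, Real.mul_self_sqrt hn0.le]
  have hb2 : b ^ 2 * n = 400 ^ 2 := by
    rw [hb, div_pow, Real.sq_sqrt hn0.le, div_mul_cancel₀ _ hn0.ne']
  set f : (Σ _ : ℕ, ℕ) × (Fin n → ℤ) → ℕ := fun l => (fr n _ M l + 2 ^ (811 * n)).toNat with hf
  have hfz : ∀ l ∈ Lam n (20 * n), (f l : ℤ) = fr n _ M l + 2 ^ (811 * n) := by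
    intro l hl
    have := abs_lt.1 (fr_bd n M l hl)
    simp only [hf]
    rw [Int.toNat_of_nonneg]
    linarith [this.1]
  have hNz : (2:ℤ) ^ (811 * n) * 2 ≤ N := by
    have h1 : 2 ^ (811 * n + 1) ≤ N := (Nat.pow_le_pow_right (by norm_num) (by omega)).trans hN
    rw [← pow_succ]; exact_mod_cast h1
  obtain ⟨a, σ, hσ, hnorm, hsum⟩ := build (Lam n (20 * n)) f (fun l => (b:ℂ) * cf n l)
    (fun l => tkey n l.1.1 l.1.2) (2 ^ n) N
    (by
      intro l hl l' hl' h
      refine hMi hl hl' ?_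
      have h1 := hfz l hl
      have h2 := hfz l' hl'
      rw [h, h2] at h1
      have h3 := add_right_cancel h1
      exact h3.symm)
    (by
      intro l hl
      have := abs_lt.1 (fr_bd n M l hl)
      have h1 := hfz l hl
      have h2 : (1:ℤ) ≤ f l := by linarith [this.1]
      have h3 : (f l : ℤ) < N := by linarith [this.2]
      exact ⟨by exact_mod_cast h2, by exact_mod_cast h3⟩) (Nat.one_le_two_pow.trans hN)
  refine ⟨a, σ, hσ, ?_, ?_, ?_⟩
  · rw [hnorm]
    have : 0 ≤ ∑ l ∈ Lam n (20 * n), ‖(b:ℂ) * cf n l‖ ^ 2 := Finset.sum_nonneg fun _ _ => by positivity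
    linarith
  · rw [hnorm]
    have : ∑ l ∈ Lam n (20 * n), ‖(b:ℂ) * cf n l‖ ^ 2 ≤ 400 ^ 2 := by
      rw [← hb2]
      simp_rw [norm_mul, mul_pow]
      rw [← Finset.mul_sum, Complex.norm_real, Real.norm_eq_abs, sq_abs]
      have := cf_l2 n (20 * n)
      gcongr
    linarith
  · refine hS2.trans (measure_mono fun x hx => ⟨hS1 hx, ?_⟩)
    obtain ⟨t, ht, hlow⟩ := low_bd n (20 * n) _ M x (hS3 x hx)
    obtain ⟨m, hm, hm2⟩ := hsum t ht
    have heq : ‖∑ k ∈ Finset.Icc 1 m, a (σ k) * trigChar (σ k : ℤ) x‖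
        = b * ‖∑ l ∈ Lam n (20 * n) with tkey n l.1.1 l.1.2 ≤ t, cf n l * trigChar (fr n _ M l) x‖ := by
      rw [hm2 x]
      have : ∑ l ∈ Lam n (20 * n) with tkey n l.1.1 l.1.2 ≤ t, (b:ℂ) * cf n l * trigChar (f l : ℤ) x
          = (b:ℂ) * (∑ l ∈ Lam n (20 * n) with tkey n l.1.1 l.1.2 ≤ t, cf n l * trigChar (fr n _ M l) x)
            * trigChar (2 ^ (811 * n)) x := by
        rw [Finset.mul_sum, Finset.sum_mul]
        refine Finset.sum_congr rfl fun l hl => ?_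
        rw [hfz l (Finset.mem_filter.1 hl).1, trigChar_add]; ring
      rw [this, norm_mul, norm_mul, norm_trigChar, mul_one, Complex.norm_real, Real.norm_eq_abs, abs_of_pos hb0]
    have hbig : 50 * Real.sqrt n ≤ ‖∑ k ∈ Finset.Icc 1 m, a (σ k) * trigChar (σ k : ℤ) x‖ := by
      rw [heq]
      calc 50 * Real.sqrt n = b * (n / 8) := by linarith
        _ ≤ _ := by gcongr; linarith
    have hlog : Real.sqrt (Real.log N) < 50 * Real.sqrt n := by
      rw [Real.sqrt_lt' (by positivity), mul_pow, Real.sq_sqrt hn0.le]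
      have hNpos : (0:ℝ) < N := by
        have : 0 < N := lt_of_lt_of_le (by positivity) hN
        exact_mod_cast this
      have h1 : Real.log N ≤ (900 * (n + 1) : ℕ) * Real.log 2 := by
        rw [← Real.log_pow]
        apply Real.log_le_log hNpos
        exact_mod_cast hN2.le
      have h2 : Real.log 2 ≤ 1 := by have := Real.log_two_lt_d9; linarith
      have h3 : ((900 * (n + 1) : ℕ):ℝ) * Real.log 2 ≤ (900 * (n + 1) : ℕ) * 1 := by gcongr
      push_cast at h1 h3
      linarith
    have hm1 : 1 ≤ m := by
      by_contra h0
      have : m = 0 := by omega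
      subst this
      simp at hbig
      linarith
    refine (hlog.trans_le hbig).trans_le ?_
    exact le_ciSup (f := fun m : Finset.Icc 1 N => ‖∑ k ∈ Finset.Icc 1 (m : ℕ), a (σ k) * trigChar (σ k : ℤ) x‖)
      (Set.finite_range _).bddAbove ⟨m, Finset.mem_Icc.2 ⟨hm1, hm⟩⟩

theorem statement15 :
    ∃ c₁ c₂ c₃ : ℝ, 0 < c₁ ∧ 0 < c₂ ∧ 0 < c₃ ∧ ∃ N₀ : ℕ, ∀ N : ℕ, N₀ < N →
      ∃ (a : ℕ → ℂ) (σ : ℕ → ℕ), Set.BijOn σ (Set.Icc 1 N) (Set.Icc 1 N) ∧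
        c₁ ≤ l2normT (fun x => ∑ k ∈ Finset.Icc 1 N, a k * trigChar (k : ℤ) x) ∧
        l2normT (fun x => ∑ k ∈ Finset.Icc 1 N, a k * trigChar (k : ℤ) x) ≤ c₂ ∧
        ENNReal.ofReal c₃ ≤
          volume {x ∈ Set.Ioc (0:ℝ) 1 | Real.sqrt (Real.log N) <
            ⨆ m : Finset.Icc 1 N,
              ‖∑ k ∈ Finset.Icc 1 (m : ℕ), a (σ k) * trigChar (σ k : ℤ) x‖} := by
  obtain ⟨e, he⟩ : ∃ e : ℕ, e = 900 * 8 := ⟨_, rfl⟩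
  refine ⟨1, (400 ^ 2 + 1) ^ ((1:ℝ)/2), 1/2, one_pos, by positivity, by norm_num, 2 ^ e, fun N hN => ?_⟩
  have hN0 : N ≠ 0 := by have := Nat.zero_le (2 ^ e); omega
  set n := Nat.log 2 N / 900 with hn
  have hL : e ≤ Nat.log 2 N := (Nat.le_log_iff_pow_le (by norm_num) hN0).2 hN.le
  have hn8 : 8 ≤ n := by omega
  have h1 : 2 ^ (900 * n) ≤ N :=
    (Nat.le_log_iff_pow_le (by norm_num) hN0).1 (by omega)
  have h2 : N < 2 ^ (900 * (n + 1)) :=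
    (Nat.log_lt_iff_lt_pow (by norm_num) hN0).1 (by omega)
  obtain ⟨a, σ, hσ, hl, hu, hv⟩ := main_n n N hn8 h1 h2
  refine ⟨a, σ, hσ, ?_, ?_, hv⟩
  · rw [l2_poly]
    exact Real.one_le_rpow hl (by norm_num)
  · rw [l2_poly]
    exact Real.rpow_le_rpow (by linarith) hu (by norm_num)
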